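/- Let G be a connected vertex-transitive non-bipartite simple graph of degree k ≥ 5 and even order that is not 4-factor-critical, let X ⊆ V(G) with |X| ≥ 4 be such that the number of odd components of G − X equals |X| − 2 and every component of G − X is factor-critical, and let p be the number of nontrivial components of G − X. Then p ≥ 1. Moreover, if G is triangle-free, then: (a) if λ₅(G) > 2k then p = 1; (b) if λ₅(G) > 4k − 8 and 5 ≤ k ≤ 6, then p = 1, |X| ≥ 7, and the unique nontrivial component H of G − X has at least 9 vertices; (c) if λ₆(G) ≥ 14 and k = 5, then p = 1, |X| ≥ 10, and the unique nontrivial component H of G − X has at least 15 vertices. -/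

import Mathlib

open SimpleGraph

section Defs

variable {V : Type*}

/-- A simple graph is vertex-transitive if any vertex can be mapped to any other
by a graph automorphism. -/
def VertexTransitive (G : SimpleGraph V) : Prop :=
  ∀ x y : V, ∃ φ : G ≃g G, φ x = y

/-- A graph is `p`-factor-critical if the removal of any set of `p` vertices
results in a graph with a perfect matching. -/
def PFactorCritical (G : SimpleGraph V) (p : ℕ) : Prop :=
  ∀ X : Set V, X.ncard = p → ∃ M : (G.induce Xᶜ).Subgraph, M.IsPerfectMatching

/-- A graph is factor-critical if the removal of any single vertex results in a
graph with a perfect matching. -/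
def IsFactorCritical {W : Type*} (H : SimpleGraph W) : Prop :=
  ∀ v : W, ∃ M : (H.induce ({v}ᶜ : Set W)).Subgraph, M.IsPerfectMatching

/-- `∇(X)`: the set of edges of `G` with exactly one end in `X`. -/
def edgeBoundary (G : SimpleGraph V) (X : Set V) : Set (Sym2 V) :=
  {e | e ∈ G.edgeSet ∧ ∃ x ∈ X, ∃ y ∈ Xᶜ, e = s(x, y)}

/-- The set of edges of `G` with both ends in `X`. -/
def edgesWithin (G : SimpleGraph V) (X : Set V) : Set (Sym2 V) :=
  {e | e ∈ G.edgeSet ∧ ∀ v ∈ e, v ∈ X}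

/-- The set of edges of `G` with one end in `A` and the other end in `S \ A`
(i.e. the edge boundary of `A` inside the induced subgraph `G[S]` when `A ⊆ S`). -/
def inducedEdgeBoundary (G : SimpleGraph V) (S A : Set V) : Set (Sym2 V) :=
  {e | e ∈ G.edgeSet ∧ ∃ x ∈ A, ∃ y ∈ S \ A, e = s(x, y)}

/-- `F` is an `s`-restricted edge-cut of `G` if deleting `F` disconnects `G` and
every component of `G − F` has at least `s` vertices. -/
def IsRestrictedEdgeCut (G : SimpleGraph V) (s : ℕ) (F : Set (Sym2 V)) : Prop :=
  F ⊆ G.edgeSet ∧ ¬ (G.deleteEdges F).Connected ∧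
    ∀ c : (G.deleteEdges F).ConnectedComponent, s ≤ c.supp.ncard

/-- `λ_s(G)`: the minimum cardinality of an `s`-restricted edge-cut of `G`. -/
noncomputable def lambdaS (G : SimpleGraph V) (s : ℕ) : ℕ :=
  sInf (Set.ncard '' {F | IsRestrictedEdgeCut G s F})

/-- A `λ_s`-fragment: a vertex set whose edge boundary is an `s`-restricted
edge-cut of minimum cardinality `λ_s(G)`. -/
def IsLambdaFragment (G : SimpleGraph V) (s : ℕ) (X : Set V) : Prop :=
  IsRestrictedEdgeCut G s (edgeBoundary G X) ∧ (edgeBoundary G X).ncard = lambdaS G s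

/-- A `λ_s`-atom: a `λ_s`-fragment of minimum cardinality. -/
def IsLambdaAtom (G : SimpleGraph V) (s : ℕ) (X : Set V) : Prop :=
  IsLambdaFragment G s X ∧ ∀ Y : Set V, IsLambdaFragment G s Y → X.ncard ≤ Y.ncard

/-- The odd girth of `G`: the length of a shortest odd cycle of `G`. -/
noncomputable def oddGirth (G : SimpleGraph V) : ℕ :=
  sInf {n | Odd n ∧ ∃ (v : V) (c : G.Walk v v), c.IsCycle ∧ c.length = n}

/-- `X` is an independent set of `G`. -/
def IsIndependentSet (G : SimpleGraph V) (X : Set V) : Prop :=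
  ∀ x ∈ X, ∀ y ∈ X, ¬ G.Adj x y

/-- The independence number `α(G)`. -/
noncomputable def indepNum (G : SimpleGraph V) : ℕ :=
  sSup {n | ∃ X : Set V, IsIndependentSet G X ∧ X.ncard = n}

/-- The number of trivial (single-vertex) components of `G − X`. -/
noncomputable def trivialComponentCount (G : SimpleGraph V) (X : Set V) : ℕ :=
  {c : (G.induce Xᶜ).ConnectedComponent | c.supp.ncard = 1}.ncard

/-- The number of odd components of `G − X`. -/
noncomputable def oddComponentCount (G : SimpleGraph V) (X : Set V) : ℕ :=
  {c : (G.induce Xᶜ).ConnectedComponent | Odd c.supp.ncard}.ncard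

/-- The number of nontrivial components of `G − X`. -/
noncomputable def nontrivialComponentCount (G : SimpleGraph V) (X : Set V) : ℕ :=
  {c : (G.induce Xᶜ).ConnectedComponent | 2 ≤ c.supp.ncard}.ncard

/-- An imprimitive block of `G`: a proper non-empty vertex set that every
automorphism either fixes setwise or maps to a disjoint set. -/
def IsImprimitiveBlock (G : SimpleGraph V) (X : Set V) : Prop :=
  X.Nonempty ∧ X ≠ Set.univ ∧ ∀ φ : G ≃g G, (⇑φ) '' X = X ∨ ((⇑φ) '' X) ∩ X = ∅

/-- A connected graph is `q`-extendable if it has a perfect matching and every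
matching of size `q` is contained in a perfect matching. -/
def Extendable (G : SimpleGraph V) (q : ℕ) : Prop :=
  (∃ M : G.Subgraph, M.IsPerfectMatching) ∧
    ∀ M : G.Subgraph, M.IsMatching → M.edgeSet.ncard = q →
      ∃ P : G.Subgraph, P.IsPerfectMatching ∧ M ≤ P

end Defs

set_option linter.unusedSectionVars false
namespace VT
variable {V : Type*}

/-- adjacency indicator -/
noncomputable def ad (G : SimpleGraph V) (u v : V) : ℕ := by
  classical exact if G.Adj u v then 1 else 0

/-- number of neighbours of `v` in `B` -/
noncomputable def dg (G : SimpleGraph V) (v : V) (B : Finset V) : ℕ := ∑ u ∈ B, ad G v u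

/-- number of ordered adjacent pairs in `A × B` -/
noncomputable def ee (G : SimpleGraph V) (A B : Finset V) : ℕ := ∑ v ∈ A, dg G v B

lemma ad_pos {G : SimpleGraph V} {u v : V} (h : G.Adj u v) : ad G u v = 1 := by
  simp [ad, h]

lemma ad_zero {G : SimpleGraph V} {u v : V} (h : ¬ G.Adj u v) : ad G u v = 0 := by
  simp [ad, h]

lemma ad_le (G : SimpleGraph V) (u v : V) : ad G u v ≤ 1 := by
  by_cases h : G.Adj u v
  · simp [ad_pos h]
  · simp [ad_zero h]

lemma ad_comm (G : SimpleGraph V) (u v : V) : ad G u v = ad G v u := by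
  by_cases h : G.Adj u v
  · simp [ad_pos h, ad_pos h.symm]
  · simp [ad_zero h, ad_zero (fun h2 => h h2.symm)]

lemma ee_comm (G : SimpleGraph V) (A B : Finset V) : ee G A B = ee G B A := by
  unfold ee dg
  rw [Finset.sum_comm]
  exact Finset.sum_congr rfl fun _ _ => Finset.sum_congr rfl fun _ _ => ad_comm _ _ _

lemma dg_mono (G : SimpleGraph V) (v : V) {A B : Finset V} (h : A ⊆ B) : dg G v A ≤ dg G v B :=
  Finset.sum_le_sum_of_subset h

lemma dg_le_card (G : SimpleGraph V) (v : V) (A : Finset V) : dg G v A ≤ A.card := by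
  unfold dg
  calc _ ≤ ∑ u ∈ A, 1 := Finset.sum_le_sum fun u _ => ad_le G v u
    _ = _ := by simp

lemma dg_eq_card (G : SimpleGraph V) (v : V) (A : Finset V) [DecidablePred fun u => G.Adj v u] :
    dg G v A = (A.filter (fun u => G.Adj v u)).card := by
  unfold dg
  rw [Finset.card_filter]
  refine Finset.sum_congr rfl fun u _ => ?_
  by_cases h : G.Adj v u
  · simp [ad_pos h, h]
  · simp [ad_zero h, h]

lemma dg_zero {G : SimpleGraph V} {v : V} {A : Finset V} (h : ∀ u ∈ A, ¬ G.Adj v u) :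
    dg G v A = 0 := Finset.sum_eq_zero fun u hu => ad_zero (h u hu)

lemma dg_pos {G : SimpleGraph V} {v u : V} {A : Finset V} (hu : u ∈ A) (h : G.Adj v u) :
    1 ≤ dg G v A := by
  rw [← ad_pos h]
  exact Finset.single_le_sum (f := fun u => ad G v u) (fun _ _ => Nat.zero_le _) hu

lemma dg_full {G : SimpleGraph V} {v : V} {A : Finset V} (h : dg G v A = A.card) :
    ∀ u ∈ A, G.Adj v u := by
  classical
  rw [dg_eq_card] at h
  exact Finset.card_filter_eq_iff.1 h

lemma exists_of_dg {G : SimpleGraph V} {v : V} {A : Finset V} (h : dg G v A ≠ 0) :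
    ∃ u ∈ A, G.Adj v u := by
  by_contra hc
  push Not at hc
  exact h (dg_zero hc)

lemma ee_zero {G : SimpleGraph V} {A B : Finset V} (h : ∀ v ∈ A, ∀ u ∈ B, ¬ G.Adj v u) :
    ee G A B = 0 := Finset.sum_eq_zero fun v hv => dg_zero (h v hv)

lemma not_adj_of_ee {G : SimpleGraph V} {A B : Finset V} (h : ee G A B = 0) :
    ∀ v ∈ A, ∀ u ∈ B, ¬ G.Adj v u := by
  intro v hv u hu hadj
  have := (Finset.sum_eq_zero_iff.1 h) v hv
  have := dg_pos hu hadj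
  omega

lemma ee_mono (G : SimpleGraph V) {A A' B B' : Finset V} (h : A ⊆ A') (h' : B ⊆ B') :
    ee G A B ≤ ee G A' B' :=
  (Finset.sum_le_sum fun v _ => dg_mono G v h').trans (Finset.sum_le_sum_of_subset h)

variable [DecidableEq V]

lemma dg_union (G : SimpleGraph V) (v : V) {A B : Finset V} (h : Disjoint A B) :
    dg G v (A ∪ B) = dg G v A + dg G v B := Finset.sum_union h

lemma ee_union_left (G : SimpleGraph V) {A B : Finset V} (C : Finset V) (h : Disjoint A B) :
    ee G (A ∪ B) C = ee G A C + ee G B C := Finset.sum_union h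

lemma ee_union_right (G : SimpleGraph V) {A B : Finset V} (C : Finset V) (h : Disjoint A B) :
    ee G C (A ∪ B) = ee G C A + ee G C B := by
  rw [ee_comm, ee_union_left G C h, ee_comm, ee_comm G B]

/-- triangle-free, in elementary form -/
def TF (G : SimpleGraph V) : Prop := ∀ a b c, G.Adj a b → G.Adj b c → G.Adj a c → False

lemma TF_of_cliqueFree {G : SimpleGraph V} (h : G.CliqueFree 3) : TF G := by
  intro a b c hab hbc hac
  exact h {a, b, c} (is3Clique_triple_iff.2 ⟨hab, hac, hbc⟩)

lemma mantel {G : SimpleGraph V} (hG : TF G) (A : Finset V) : 2 * ee G A A ≤ A.card ^ 2 := by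
  classical
  have h1 : ∀ u ∈ A, ∀ v ∈ A, ad G u v * (dg G u A + dg G v A) ≤ ad G u v * A.card := by
    intro u _ v _
    by_cases h : G.Adj u v
    · rw [ad_pos h, one_mul, one_mul, dg_eq_card, dg_eq_card, ← Finset.card_union_of_disjoint]
      · exact Finset.card_le_card (Finset.union_subset (Finset.filter_subset _ _)
          (Finset.filter_subset _ _))
      · rw [Finset.disjoint_left]
        intro z hz hz'
        simp only [Finset.mem_filter] at hz hz'
        exact hG u v z h hz'.2 hz.2
    · simp [ad_zero h]
  have h2 : ∑ u ∈ A, ∑ v ∈ A, ad G u v * (dg G u A + dg G v A)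
      = 2 * ∑ u ∈ A, dg G u A ^ 2 := by
    simp only [mul_add, Finset.sum_add_distrib]
    have e1 : ∑ u ∈ A, ∑ v ∈ A, ad G u v * dg G u A = ∑ u ∈ A, dg G u A ^ 2 := by
      refine Finset.sum_congr rfl fun u _ => ?_
      rw [← Finset.sum_mul, sq]; rfl
    have e2 : ∑ u ∈ A, ∑ v ∈ A, ad G u v * dg G v A = ∑ u ∈ A, dg G u A ^ 2 := by
      rw [Finset.sum_comm, ← e1]
      exact Finset.sum_congr rfl fun _ _ => Finset.sum_congr rfl fun _ _ => by rw [ad_comm]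
    rw [e1, e2]; ring
  have h3 : 2 * ∑ u ∈ A, dg G u A ^ 2 ≤ ee G A A * A.card := by
    rw [← h2]
    calc _ ≤ ∑ u ∈ A, ∑ v ∈ A, ad G u v * A.card :=
          Finset.sum_le_sum fun u hu => Finset.sum_le_sum fun v hv => h1 u hu v hv
      _ = _ := by simp only [← Finset.sum_mul]; rfl
  have h4 : (ee G A A) ^ 2 ≤ A.card * ∑ u ∈ A, dg G u A ^ 2 := sq_sum_le_card_mul_sum_sq
  rcases Nat.eq_zero_or_pos (ee G A A) with h0 | h0
  · simp [h0]
  · have : ee G A A * (2 * ee G A A) ≤ ee G A A * A.card ^ 2 := by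
      nlinarith [Nat.mul_le_mul_left A.card h3]
    exact Nat.le_of_mul_le_mul_left this h0

variable [Fintype V]

/-- edge boundary size -/
noncomputable def bd (G : SimpleGraph V) (A : Finset V) : ℕ := ee G A Aᶜ

lemma bd_compl (G : SimpleGraph V) (A : Finset V) : bd G Aᶜ = bd G A := by
  unfold bd; rw [compl_compl, ee_comm]

/-- regularity -/
def Rg (G : SimpleGraph V) (k : ℕ) : Prop := ∀ v, dg G v Finset.univ = k

lemma ee_univ {G : SimpleGraph V} {k : ℕ} (hr : Rg G k) (A : Finset V) :
    ee G A Finset.univ = k * A.card := by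
  unfold ee; rw [Finset.sum_congr rfl (fun v _ => hr v)]; simp [mul_comm]

lemma ee_split {G : SimpleGraph V} {k : ℕ} (hr : Rg G k) (A B : Finset V) :
    ee G A B + ee G A Bᶜ = k * A.card := by
  rw [← ee_union_right G A disjoint_compl_right, Finset.union_compl, ee_univ hr]

lemma bd_add {G : SimpleGraph V} {k : ℕ} (hr : Rg G k) (A : Finset V) :
    ee G A A + bd G A = k * A.card := ee_split hr A A

lemma bd_mantel {G : SimpleGraph V} {k : ℕ} (hr : Rg G k) (hG : TF G) (A : Finset V) :
    2 * k * A.card ≤ 2 * bd G A + A.card ^ 2 := by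
  have := bd_add hr A; have := mantel hG A; nlinarith

lemma ee_self_even (G : SimpleGraph V) (A : Finset V) : Even (ee G A A) := by
  induction A using Finset.induction_on with
  | empty => simp [ee]
  | insert a s ha ih =>
    have hd : Disjoint {a} s := Finset.disjoint_singleton_left.2 ha
    rw [Finset.insert_eq, ee_union_left G _ hd, ee_union_right G _ hd, ee_union_right G _ hd,
      ee_comm G s {a}]
    have : ee G {a} {a} = 0 := by simp [ee, dg, ad]
    rw [this]
    obtain ⟨r, hr⟩ := ih
    exact ⟨ee G {a} s + r, by omega⟩

end VT

set_option linter.unusedSectionVars false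

namespace VT
variable {V : Type*} [DecidableEq V] [Fintype V]

lemma ncard_edgeBoundary_le (G : SimpleGraph V) (A : Finset V) :
    (edgeBoundary G (A : Set V)).ncard ≤ bd G A := by
  classical
  have h1 : edgeBoundary G (A : Set V) ⊆
      ((((A ×ˢ Aᶜ).filter (fun q => G.Adj q.1 q.2)).image (fun q => s(q.1, q.2)) :
        Finset (Sym2 V)) : Set (Sym2 V)) := by
    rintro e ⟨he, x, hx, y, hy, rfl⟩
    simp only [Finset.coe_image, Set.mem_image, Finset.mem_coe, Finset.mem_filter,
      Finset.mem_product]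
    exact ⟨(x, y), ⟨⟨by simpa using hx, by simpa using hy⟩, by simpa using he⟩, rfl⟩
  refine (Set.ncard_le_ncard h1 (Finset.finite_toSet _)).trans ?_
  rw [Set.ncard_coe_finset]
  refine Finset.card_image_le.trans ?_
  rw [Finset.card_filter, Finset.sum_product]
  unfold bd ee
  refine Finset.sum_le_sum fun u _ => ?_
  rw [dg_eq_card, Finset.card_filter]

lemma reach_mem {G : SimpleGraph V} {A : Finset V} {u v : V}
    (h : (G.deleteEdges (edgeBoundary G (A : Set V))).Reachable u v) : u ∈ A ↔ v ∈ A := by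
  obtain ⟨p⟩ := h
  induction p with
  | nil => rfl
  | @cons a b c hab p ih =>
    rw [← ih]
    rw [deleteEdges_adj] at hab
    obtain ⟨hab, hn⟩ := hab
    constructor
    · intro ha
      by_contra hb
      exact hn ⟨hab, a, by simpa using ha, b, by simpa using hb, rfl⟩
    · intro hb
      by_contra ha
      exact hn ⟨hab, b, by simpa using hb, a, by simpa using ha, Sym2.eq_swap⟩

lemma bd_sdiff {G : SimpleGraph V} {A C : Finset V} (hC : C ⊆ A)
    (h : ∀ u ∈ C, ∀ v ∈ A, G.Adj u v → v ∈ C) : bd G A = bd G C + bd G (A \ C) := by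
  have h0 : ee G C (A \ C) = 0 := ee_zero (by
    intro v hv u hu hadj
    exact (Finset.mem_sdiff.1 hu).2 (h v hv u (Finset.mem_sdiff.1 hu).1 hadj))
  have hA : A = C ∪ (A \ C) := (Finset.union_sdiff_of_subset hC).symm
  have hd : Disjoint C (A \ C) := Finset.disjoint_sdiff
  have e1 : Cᶜ = (A \ C) ∪ Aᶜ := by
    ext x; simp only [Finset.mem_compl, Finset.mem_union, Finset.mem_sdiff]
    have := @hC x; tauto
  have e2 : (A \ C)ᶜ = C ∪ Aᶜ := by
    ext x; simp only [Finset.mem_compl, Finset.mem_union, Finset.mem_sdiff]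
    have := @hC x; tauto
  have d1 : Disjoint (A \ C) Aᶜ := disjoint_compl_right.mono_left Finset.sdiff_subset
  have d2 : Disjoint C Aᶜ := disjoint_compl_right.mono_left hC
  unfold bd
  rw [e1, e2, ee_union_right G _ d1, ee_union_right G _ d2, h0, ee_comm G (A \ C) C, h0]
  have : ee G A Aᶜ = ee G (C ∪ A \ C) Aᶜ := by rw [← hA]
  rw [this, ee_union_left G _ hd]; omega

theorem lam {G : SimpleGraph V} {k : ℕ} (hr : Rg G k) (hG : TF G) (s : ℕ) (hs : 1 ≤ s)
    (hsk : s ≤ 2 * k) : ∀ (n : ℕ) (A : Finset V), bd G A = n → s ≤ A.card → s ≤ Aᶜ.card →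
    lambdaS G s ≤ bd G A ∨ s * (2 * k + 1 - s) ≤ 2 * bd G A := by
  classical
  intro n
  induction n using Nat.strong_induction_on with
  | _ n ih =>
  intro A hAn hA hAc
  by_cases hall : ∀ c : (G.deleteEdges (edgeBoundary G (A : Set V))).ConnectedComponent,
      s ≤ c.supp.ncard
  · left
    refine le_trans (Nat.sInf_le ⟨edgeBoundary G (A : Set V), ⟨?_, ?_, hall⟩, rfl⟩)
      (ncard_edgeBoundary_le G A)
    · intro e he; exact he.1
    · intro hcon
      obtain ⟨a, ha⟩ := Finset.card_pos.1 (lt_of_lt_of_le hs hA)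
      obtain ⟨b, hb⟩ := Finset.card_pos.1 (lt_of_lt_of_le hs hAc)
      exact (Finset.mem_compl.1 hb) ((reach_mem (hcon.preconnected a b)).1 ha)
  · push Not at hall
    obtain ⟨c, hc⟩ := hall
    obtain ⟨v, rfl⟩ := c.exists_rep
    set F := edgeBoundary G (A : Set V) with hF
    -- general step
    have step : ∀ B : Finset V, bd G B = n → s ≤ B.card → s ≤ Bᶜ.card →
        (∀ x y, (G.deleteEdges F).Reachable x y → (x ∈ B ↔ y ∈ B)) →
        (∀ x ∈ B, ∀ y ∈ B, G.Adj x y → (G.deleteEdges F).Adj x y) → v ∈ B →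
        lambdaS G s ≤ n ∨ s * (2 * k + 1 - s) ≤ 2 * n := by
      intro B hBn hB hBc hreach hadj hv
      set C : Finset V := B.filter (fun u => (G.deleteEdges F).Reachable v u) with hCdef
      have hCB : C ⊆ B := Finset.filter_subset _ _
      have hCcard : C.card < s := by
        refine lt_of_eq_of_lt ?_ hc
        rw [← Set.ncard_coe_finset]
        congr 1
        ext u
        simp only [hCdef, Finset.coe_filter, Set.mem_ofPred_eq]
        constructor
        · rintro ⟨_, h⟩
          exact ConnectedComponent.sound h.symm
        · intro h
          have h' : (G.deleteEdges F).Reachable u v := ConnectedComponent.exact h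
          exact ⟨(hreach _ _ h'.symm).1 hv, h'.symm⟩
      have hclosed : ∀ u ∈ C, ∀ w ∈ B, G.Adj u w → w ∈ C := by
        intro u hu w hw huw
        rw [hCdef, Finset.mem_filter] at hu ⊢
        exact ⟨hw, hu.2.trans (hadj u hu.1 w hw huw).reachable⟩
      have hsum := bd_sdiff hCB hclosed
      have hvC : v ∈ C := Finset.mem_filter.2 ⟨hv, Reachable.refl v⟩
      have hCpos : 1 ≤ C.card := Finset.card_pos.2 ⟨v, hvC⟩
      have m1 := bd_mantel hr hG C
      have m2 := bd_mantel hr hG (B \ C)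
      have hcc : (B \ C).card + C.card = B.card := Finset.card_sdiff_add_card_eq_card hCB
      by_cases hbig : s ≤ (B \ C).card
      · have hpos : 0 < bd G C := by
          by_contra h0
          have h0' : bd G C = 0 := by omega
          rw [h0'] at m1
          nlinarith
        have hlt : bd G (B \ C) < n := by omega
        have hcompl : s ≤ (B \ C)ᶜ.card := hBc.trans (Finset.card_le_card (by
          intro x; simp only [Finset.mem_compl, Finset.mem_sdiff]; tauto))
        rcases ih _ hlt (B \ C) rfl hbig hcompl with h | h
        · left; omega
        · right; omega
      · right
        obtain ⟨d, hd⟩ : ∃ d, 2 * k = s + d := ⟨2 * k - s, by omega⟩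
        have e : 2 * k + 1 - s = d + 1 := by omega
        rw [e]
        have hDlt : (B \ C).card < s := by omega
        have a1 : C.card * (d + 1) ≤ 2 * bd G C := by nlinarith
        have a2 : (B \ C).card * (d + 1) ≤ 2 * bd G (B \ C) := by nlinarith
        have a3 : s * (d + 1) ≤ B.card * (d + 1) := Nat.mul_le_mul_right _ hB
        rw [← hBn, hsum]
        nlinarith
    rw [hAn]
    by_cases hv : v ∈ A
    · refine step A hAn hA hAc (fun x y h => reach_mem h) ?_ hv
      intro x hx y hy hxy
      rw [deleteEdges_adj]
      refine ⟨hxy, ?_⟩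
      rintro ⟨_, a, ha, b, hb, he⟩
      rcases Sym2.eq_iff.1 he with ⟨rfl, rfl⟩ | ⟨rfl, rfl⟩
      · exact hb (by simpa using hy)
      · exact hb (by simpa using hx)
    · refine step Aᶜ (by rw [bd_compl, hAn]) hAc (by rwa [compl_compl])
        (fun x y h => by rw [Finset.mem_compl, Finset.mem_compl, reach_mem h]) ?_
        (Finset.mem_compl.2 hv)
      intro x hx y hy hxy
      rw [deleteEdges_adj]
      refine ⟨hxy, ?_⟩
      rintro ⟨_, a, ha, b, hb, he⟩
      rw [Finset.mem_compl] at hx hy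
      rcases Sym2.eq_iff.1 he with ⟨rfl, rfl⟩ | ⟨rfl, rfl⟩
      · exact hx (by simpa using ha)
      · exact hy (by simpa using ha)

end VT

set_option linter.unusedSectionVars false

namespace VT
variable {V : Type*}

/-- closed walk of length `g`, as a periodic sequence -/
def CW (G : SimpleGraph V) (g : ℕ) (w : ℕ → V) : Prop :=
  (∀ i, G.Adj (w i) (w (i + 1))) ∧ ∀ i, w (i + g) = w i

/-- shortest odd closed walk -/
def MinOdd (G : SimpleGraph V) (g : ℕ) (w : ℕ → V) : Prop :=
  CW G g w ∧ Odd g ∧ ∀ v (q : G.Walk v v), Odd q.length → g ≤ q.length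

lemma exists_minOdd {G : SimpleGraph V} (h : ¬ G.Colorable 2) : ∃ g w, MinOdd G g w := by
  classical
  rw [two_colorable_iff_forall_loop_even] at h
  push Not at h
  obtain ⟨u, p, hp⟩ := h
  rw [Nat.not_even_iff_odd] at hp
  have hex : ∃ g, ∃ (v : V) (q : G.Walk v v), Odd q.length ∧ q.length = g :=
    ⟨p.length, u, p, hp, rfl⟩
  obtain ⟨v, q, hq, hg⟩ := Nat.find_spec hex
  set g := Nat.find hex with hgdef
  have hgpos : 0 < g := by rw [← hg]; exact hq.pos
  refine ⟨g, fun i => q.getVert (i % g), ⟨⟨?_, ?_⟩, hg ▸ hq, ?_⟩⟩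
  · intro i
    have hlt : i % g < q.length := by rw [hg]; exact Nat.mod_lt _ hgpos
    have hadj := q.adj_getVert_succ hlt
    have : q.getVert ((i + 1) % g) = q.getVert (i % g + 1) := by
      rw [Nat.add_mod]
      rcases Nat.lt_or_ge (i % g + 1) g with hl | hl
      · have : 1 % g = 1 := Nat.mod_eq_of_lt (by omega)
        rw [this, Nat.mod_eq_of_lt hl]
      · have e : i % g + 1 = g := by omega
        rw [Nat.add_mod_mod, e, Nat.mod_self]
        rw [show q.getVert g = q.getVert q.length by rw [hg], Walk.getVert_zero,
          Walk.getVert_length]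
    change G.Adj (q.getVert (i % g)) (q.getVert ((i + 1) % g))
    rw [this]; exact hadj
  · intro i; simp
  · intro v' q' hq'
    exact Nat.find_min' hex ⟨v', q', hq', rfl⟩

lemma CW.walk {G : SimpleGraph V} {g : ℕ} {w : ℕ → V} (h : CW G g w) (i n : ℕ) :
    ∃ q : G.Walk (w i) (w (i + n)), q.length = n := by
  induction n with
  | zero => exact ⟨Walk.nil, rfl⟩
  | succ n ih =>
    obtain ⟨q, hq⟩ := ih
    exact ⟨q.concat (h.1 (i + n)), by simp [hq]⟩

lemma MinOdd.seg {G : SimpleGraph V} {g : ℕ} {w : ℕ → V} (h : MinOdd G g w) {i n : ℕ}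
    (hn : Odd n) (he : w i = w (i + n)) : g ≤ n := by
  obtain ⟨q, hq⟩ := h.1.walk i n
  have := h.2.2 _ (q.copy rfl he.symm) (by simpa [hq] using hn)
  simpa [hq] using this

lemma MinOdd.seg1 {G : SimpleGraph V} {g : ℕ} {w : ℕ → V} (h : MinOdd G g w) {i n : ℕ}
    (hn : Odd (n + 1)) (he : G.Adj (w (i + n)) (w i)) : g ≤ n + 1 := by
  obtain ⟨q, hq⟩ := h.1.walk i n
  have := h.2.2 _ (q.concat he) (by simpa [hq] using hn)
  simpa [hq] using this

lemma MinOdd.seg2 {G : SimpleGraph V} {g : ℕ} {w : ℕ → V} (h : MinOdd G g w) {i n : ℕ} {v : V}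
    (hn : Odd n) (h1 : G.Adj v (w i)) (h2 : G.Adj v (w (i + n))) : g ≤ n + 2 := by
  obtain ⟨q, hq⟩ := h.1.walk i n
  have := h.2.2 _ ((Walk.cons h1 q).concat h2.symm) (by
    simp only [Walk.length_concat, Walk.length_cons, hq]
    exact hn.add_even even_two)
  simpa [hq] using this

lemma MinOdd.three {G : SimpleGraph V} {g : ℕ} {w : ℕ → V} (h : MinOdd G g w) (hg : 5 ≤ g)
    {v : V} {i j l : ℕ} (hij : i < j) (hjl : j < l) (hl : l < i + g)
    (h1 : G.Adj v (w i)) (h2 : G.Adj v (w j)) (h3 : G.Adj v (w l)) : False := by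
  have hgo := h.2.1
  have s1 : Odd (j - i) → g ≤ (j - i) + 2 := fun ho =>
    h.seg2 ho h1 (by rwa [Nat.add_sub_cancel' hij.le])
  have s2 : Odd (l - j) → g ≤ (l - j) + 2 := fun ho =>
    h.seg2 ho h2 (by rwa [Nat.add_sub_cancel' hjl.le])
  have s3 : Odd (i + g - l) → g ≤ (i + g - l) + 2 := fun ho =>
    h.seg2 ho h3 (by rw [Nat.add_sub_cancel' hl.le, h.1.2]; exact h1)
  rw [Nat.odd_iff] at *
  omega

lemma MinOdd.le_two {G : SimpleGraph V} {g : ℕ} {w : ℕ → V} (h : MinOdd G g w) (hg : 5 ≤ g)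
    (v : V) : ∑ i ∈ Finset.range g, ad G v (w i) ≤ 2 := by
  classical
  have e : ∑ i ∈ Finset.range g, ad G v (w i)
      = ((Finset.range g).filter (fun i => G.Adj v (w i))).card := by
    rw [Finset.card_filter]
    refine Finset.sum_congr rfl fun i _ => ?_
    by_cases hh : G.Adj v (w i)
    · simp [ad_pos hh, hh]
    · simp [ad_zero hh, hh]
  rw [e]
  by_contra hc
  push Not at hc
  obtain ⟨a, b, c, ha, hb, hc, hab, hac, hbc⟩ := Finset.two_lt_card_iff.1 hc
  simp only [Finset.mem_filter, Finset.mem_range] at ha hb hc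
  obtain ⟨ha, ha'⟩ := ha
  obtain ⟨hb, hb'⟩ := hb
  obtain ⟨hc, hc'⟩ := hc
  rcases lt_or_gt_of_ne hab with h1 | h1 <;> rcases lt_or_gt_of_ne hac with h2 | h2 <;>
    rcases lt_or_gt_of_ne hbc with h3 | h3
  · exact h.three hg h1 h3 (by omega) ha' hb' hc'
  · exact h.three hg h2 h3 (by omega) ha' hc' hb'
  · omega
  · exact h.three hg h2 h1 (by omega) hc' ha' hb'
  · exact h.three hg h1 h2 (by omega) hb' ha' hc'
  · omega
  · exact h.three hg h3 h2 (by omega) hb' hc' ha'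
  · exact h.three hg h3 h1 (by omega) hc' hb' ha'

lemma MinOdd.inj {G : SimpleGraph V} {g : ℕ} {w : ℕ → V} (h : MinOdd G g w) :
    Set.InjOn w (Finset.range g : Set ℕ) := by
  have key : ∀ i j, i < j → j < g → w i ≠ w j := by
    intro i j hij hj he
    have hgo := h.2.1
    rcases Nat.even_or_odd (j - i) with ho | ho
    · have : g ≤ i + g - j := h.seg (i := j) (n := i + g - j) (by
        rw [Nat.odd_iff] at *; rw [Nat.even_iff] at ho; omega) (by
        rw [show j + (i + g - j) = i + g by omega, h.1.2]; exact he.symm)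
      omega
    · have : g ≤ j - i := h.seg ho (by rw [Nat.add_sub_cancel' hij.le]; exact he)
      omega
  intro i hi j hj he
  simp only [Finset.coe_range, Set.mem_Iio] at hi hj
  rcases lt_trichotomy i j with hl | hl | hl
  · exact absurd he (key i j hl hj)
  · exact hl
  · exact absurd he.symm (key j i hl hi)

lemma MinOdd.three_le {G : SimpleGraph V} {g : ℕ} {w : ℕ → V} (h : MinOdd G g w) : 3 ≤ g := by
  obtain ⟨r, hr⟩ := h.2.1
  rcases Nat.eq_zero_or_pos r with h0 | h0
  · have : g = 1 := by omega
    subst this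
    have h1 := h.1.1 0
    rw [h.1.2 0] at h1
    exact absurd h1 (G.loopless.irrefl _)
  · omega

lemma MinOdd.five_le [DecidableEq V] {G : SimpleGraph V} {g : ℕ} {w : ℕ → V} (h : MinOdd G g w)
    (hG : TF G) : 5 ≤ g := by
  have h3 := h.three_le
  obtain ⟨r, hr⟩ := h.2.1
  by_contra hc
  have : g = 3 := by omega
  subst this
  have h1 := h.1.1 2
  rw [show (2 : ℕ) + 1 = 0 + 3 by rfl, h.1.2 0] at h1
  exact hG _ _ _ (h.1.1 0) (h.1.1 1) h1.symm

/-- hits of an independent set on an odd closed walk -/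
lemma CW.indep {G : SimpleGraph V} {g : ℕ} {w : ℕ → V} (h : CW G g w) (P : V → ℕ)
    (hP : ∀ u v, G.Adj u v → P u + P v ≤ 1) :
    2 * ∑ i ∈ Finset.range g, P (w i) ≤ g := by
  have e : ∑ i ∈ Finset.range g, P (w (i + 1)) = ∑ i ∈ Finset.range g, P (w i) := by
    have h1 := Finset.sum_range_succ (fun i => P (w i)) g
    have h2 := Finset.sum_range_succ' (fun i => P (w i)) g
    have h3 : w g = w 0 := by have := h.2 0; rwa [Nat.zero_add] at this
    rw [h3] at h1
    omega
  calc 2 * ∑ i ∈ Finset.range g, P (w i)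
      = ∑ i ∈ Finset.range g, (P (w i) + P (w (i + 1))) := by
        rw [Finset.sum_add_distrib, e]; ring
    _ ≤ ∑ i ∈ Finset.range g, 1 := Finset.sum_le_sum fun i _ => hP _ _ (h.1 i)
    _ = g := by simp

lemma CW.map {G : SimpleGraph V} {g : ℕ} {w : ℕ → V} (h : CW G g w) (φ : G ≃g G) :
    CW G g (fun i => φ (w i)) :=
  ⟨fun i => φ.map_adj_iff.2 (h.1 i), fun i => congrArg φ (h.2 i)⟩

variable [DecidableEq V] [Fintype V]

/-- averaging over the automorphism group -/
lemma averaging {G : SimpleGraph V} (hvt : VertexTransitive G) (S : Finset V) {g m : ℕ} {w : ℕ → V}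
    (hb : ∀ φ : G ≃g G, ∑ i ∈ Finset.range g, (if φ (w i) ∈ S then 1 else 0) ≤ m) :
    g * S.card ≤ m * Fintype.card V := by
  classical
  have : Finite (G ≃g G) := DFunLike.finite _
  have : Fintype (G ≃g G) := Fintype.ofFinite _
  set a := Fintype.card (G ≃g G) with ha
  have hapos : 0 < a := Fintype.card_pos_iff.2 ⟨RelIso.refl _⟩
  have hconst : ∀ v u u' : V, (Finset.univ.filter (fun φ : G ≃g G => φ v = u)).card ≤
      (Finset.univ.filter (fun φ : G ≃g G => φ v = u')).card := by
    intro v u u'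
    obtain ⟨ψ, hψ⟩ := hvt u u'
    refine Finset.card_le_card_of_injOn (fun φ => φ.trans ψ) ?_ ?_
    · intro φ hφ
      simp only [Finset.coe_filter, Finset.mem_univ, true_and, Set.mem_ofPred_eq] at hφ ⊢
      simp [hφ, hψ]
    · intro φ _ φ' _ he
      ext x
      have := DFunLike.congr_fun he x
      exact ψ.injective this
  have hv : ∀ v : V, Fintype.card V * ∑ φ : G ≃g G, (if φ v ∈ S then 1 else 0) = a * S.card := by
    intro v
    have e1 : ∀ T : Finset V, ∑ φ : G ≃g G, (if φ v ∈ T then 1 else 0)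
        = T.card * (Finset.univ.filter (fun φ : G ≃g G => φ v = v)).card := by
      intro T
      rw [← Finset.card_filter]
      rw [Finset.card_eq_sum_card_fiberwise (f := fun φ : G ≃g G => φ v) (t := T)]
      · rw [Finset.sum_congr rfl (g := fun _ =>
          (Finset.univ.filter (fun φ : G ≃g G => φ v = v)).card)]
        · simp
        · intro u hu
          refine le_antisymm ?_ ?_
          · refine le_trans (Finset.card_le_card ?_) (hconst v u v)
            intro φ; simp only [Finset.mem_filter, Finset.mem_univ, true_and]; tauto
          · refine le_trans (hconst v v u) (Finset.card_le_card ?_)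
            intro φ; simp only [Finset.mem_filter, Finset.mem_univ, true_and]
            intro h; exact ⟨h ▸ hu, h⟩
      · intro φ hφ
        simpa using hφ
    have e2 := e1 Finset.univ
    simp only [Finset.mem_univ, if_true, Finset.sum_const, Finset.card_univ, smul_eq_mul,
      mul_one] at e2
    rw [e1 S, ha, e2]; ring
  have tot : ∑ φ : G ≃g G, ∑ i ∈ Finset.range g, (if φ (w i) ∈ S then 1 else 0) ≤ a * m := by
    refine (Finset.sum_le_sum fun φ _ => hb φ).trans ?_
    simp [ha]
  rw [Finset.sum_comm] at tot
  have : Fintype.card V * ∑ i ∈ Finset.range g, ∑ φ : G ≃g G, (if φ (w i) ∈ S then 1 else 0)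
      = g * (a * S.card) := by
    rw [Finset.mul_sum, Finset.sum_congr rfl fun i _ => hv (w i)]; simp
  have h2 := Nat.mul_le_mul_left (Fintype.card V) tot
  rw [this] at h2
  refine le_of_mul_le_mul_left (a := a) ?_ hapos
  nlinarith

lemma averaging_indep {G : SimpleGraph V} (hvt : VertexTransitive G) (S : Finset V) {g : ℕ}
    {w : ℕ → V} (hw : CW G g w) (hg : Odd g) (hS : ∀ u ∈ S, ∀ v ∈ S, ¬ G.Adj u v) :
    2 * (g * S.card) ≤ (g - 1) * Fintype.card V := by
  obtain ⟨r, hr⟩ := hg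
  have := averaging hvt S (g := g) (m := r) (w := w) (fun φ => by
    have := (hw.map φ).indep (fun v => if v ∈ S then 1 else 0) (by
      intro u v huv
      by_cases hu : u ∈ S <;> by_cases hv : v ∈ S <;> simp [hu, hv]
      exact hS u hu v hv huv)
    omega)
  have e : g - 1 = 2 * r := by omega
  rw [e]; nlinarith

end VT

set_option linter.unusedSectionVars false

namespace VT
variable {V : Type*} [DecidableEq V] [Fintype V]

lemma sum_walk_deg {G : SimpleGraph V} {k g : ℕ} {w : ℕ → V} (hr : Rg G k) (h : MinOdd G g w)
    (hg : 5 ≤ g) : g * k ≤ 2 * Fintype.card V := by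
  have e : ∑ i ∈ Finset.range g, dg G (w i) Finset.univ = g * k := by
    rw [Finset.sum_congr rfl fun i _ => hr (w i)]; simp
  rw [← e]
  unfold dg
  rw [Finset.sum_comm]
  calc _ ≤ ∑ v : V, 2 := Finset.sum_le_sum fun v _ => by
        rw [Finset.sum_congr rfl fun i _ => ad_comm G (w i) v]
        exact h.le_two hg v
    _ = _ := by simp [mul_comm]

/-- no independent set of size `n/2 - 1` -/
theorem no_big_indep {G : SimpleGraph V} {k : ℕ} (hvt : VertexTransitive G)
    (hnb : ¬ G.Colorable 2) (hr : Rg G k) (hk : 5 ≤ k) (I : Finset V) (hI1 : I.Nonempty)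
    (hI : ∀ u ∈ I, ∀ v ∈ I, ¬ G.Adj u v) (hn : Fintype.card V = 2 * I.card + 2) : False := by
  obtain ⟨g, w, hw⟩ := exists_minOdd hnb
  have h3 := hw.three_le
  have hav := averaging_indep hvt I hw.1 hw.2.1 hI
  obtain ⟨d, rfl⟩ : ∃ d, g = d + 1 := ⟨g - 1, by omega⟩
  rw [Nat.add_sub_cancel, hn] at hav
  have hle : I.card ≤ d := by nlinarith
  rcases Nat.lt_or_ge (d + 1) 5 with h5 | h5
  · have hodd := hw.2.1
    rw [Nat.odd_iff] at hodd
    have hd : d = 2 := by omega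
    obtain ⟨u, hu⟩ := hI1
    have h1 := hr u
    have h2 : dg G u Finset.univ = dg G u I + dg G u Iᶜ := by
      rw [← dg_union G u disjoint_compl_right, Finset.union_compl]
    have h4 : dg G u I = 0 := dg_zero (hI u hu)
    have h6 := dg_le_card G u Iᶜ
    rw [Finset.card_compl] at h6
    omega
  · have := sum_walk_deg hr hw h5
    nlinarith

/-- the twin class of `v` -/
noncomputable def tw (G : SimpleGraph V) (v : V) : Finset V := by
  classical exact Finset.univ.filter (fun u => ∀ z, G.Adj u z ↔ G.Adj v z)

lemma mem_tw {G : SimpleGraph V} {u v : V} : u ∈ tw G v ↔ ∀ z, G.Adj u z ↔ G.Adj v z := by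
  simp [tw]

lemma tw_eq {G : SimpleGraph V} {u v : V} (h : u ∈ tw G v) : tw G u = tw G v := by
  ext x
  rw [mem_tw] at *
  rw [mem_tw]
  simp only [h]

lemma tw_disj {G : SimpleGraph V} {u v : V} (h : u ∉ tw G v) : Disjoint (tw G u) (tw G v) := by
  rw [Finset.disjoint_left]
  intro x hx hx'
  rw [mem_tw] at *
  exact h fun z => (hx z).symm.trans (hx' z)

lemma tw_card_le {G : SimpleGraph V} (hvt : VertexTransitive G) (u v : V) :
    (tw G u).card ≤ (tw G v).card := by
  obtain ⟨φ, hφ⟩ := hvt u v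
  refine Finset.card_le_card_of_injOn φ ?_ φ.injective.injOn
  intro x hx
  have hx' : ∀ z, G.Adj x z ↔ G.Adj u z := mem_tw.1 hx
  refine mem_tw.2 fun z => ?_
  obtain ⟨z', rfl⟩ := φ.surjective z
  rw [← hφ, φ.map_adj_iff, φ.map_adj_iff, hx']

lemma tw_card {G : SimpleGraph V} (hvt : VertexTransitive G) (u v : V) :
    (tw G u).card = (tw G v).card := le_antisymm (tw_card_le hvt u v) (tw_card_le hvt v u)

lemma tw_dvd {G : SimpleGraph V} {k : ℕ} (hvt : VertexTransitive G) (hr : Rg G k) (v : V) :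
    (tw G v).card ∣ k := by
  classical
  have h1 := hr v
  rw [dg_eq_card] at h1
  set N := Finset.univ.filter (fun u => G.Adj v u) with hN
  rw [← h1, Finset.card_eq_sum_card_image (fun u => tw G u) N]
  refine Finset.dvd_sum fun c hc => ?_
  obtain ⟨u, hu, rfl⟩ := Finset.mem_image.1 hc
  have : N.filter (fun x => tw G x = tw G u) = tw G u := by
    ext x
    rw [Finset.mem_filter]
    constructor
    · rintro ⟨_, h⟩
      rw [← h]; exact mem_tw.2 fun z => Iff.rfl
    · intro hx
      refine ⟨?_, tw_eq hx⟩
      rw [hN, Finset.mem_filter] at hu ⊢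
      exact ⟨Finset.mem_univ _, (((mem_tw.1 hx) v).2 hu.2.symm).symm⟩
  rw [this, tw_card hvt u v]

lemma tw_sub {G : SimpleGraph V} {v u x : V} (h : G.Adj v u) (hx : x ∈ tw G u) : G.Adj v x :=
  (((mem_tw.1 hx) v).2 h.symm).symm

lemma MinOdd.not_tw {G : SimpleGraph V} {g : ℕ} {w : ℕ → V} (h : MinOdd G g w) (i : ℕ) :
    w (i + 2) ∉ tw G (w i) := by
  intro hm
  have h3 := h.three_le
  have h1 := ((mem_tw.1 hm) (w (i + 3))).1 (h.1.1 (i + 2))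
  obtain ⟨r, hr⟩ := h.2.1
  have := h.seg1 (i := i + 3) (n := g - 3) ⟨r - 1, by omega⟩ (by
    rw [show i + 3 + (g - 3) = i + g by omega, h.1.2]; exact h1)
  omega

lemma nbr_card {G : SimpleGraph V} {k : ℕ} (hr : Rg G k) (v : V) :
    ∃ N : Finset V, N.card = k ∧ ∀ u, u ∈ N ↔ G.Adj v u := by
  classical
  have h1 := hr v
  rw [dg_eq_card] at h1
  exact ⟨_, h1, by simp⟩

lemma tw_lt {G : SimpleGraph V} {k : ℕ} (hvt : VertexTransitive G)
    (hnb : ¬ G.Colorable 2) (hr : Rg G k) (v : V) : 2 * (tw G v).card ≤ k := by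
  obtain ⟨g, w, hw⟩ := exists_minOdd hnb
  obtain ⟨N, hN, hmem⟩ := nbr_card hr (w 1)
  have hd := tw_disj (hw.not_tw 0)
  rw [← hN, two_mul]
  have e : (tw G (w (0 + 2))).card + (tw G (w 0)).card = (tw G v).card + (tw G v).card := by
    rw [tw_card hvt _ v, tw_card hvt (w 0) v]
  rw [← e, ← Finset.card_union_of_disjoint hd]
  refine Finset.card_le_card fun x hx => ?_
  rw [hmem]
  rcases Finset.mem_union.1 hx with h | h
  · exact tw_sub (hw.1.1 1) h
  · exact tw_sub (hw.1.1 0).symm h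

theorem twins5 {G : SimpleGraph V} (hvt : VertexTransitive G)
    (hnb : ¬ G.Colorable 2) (hr : Rg G 5) (v : V) : (tw G v).card ≤ 1 := by
  have h1 := tw_lt hvt hnb hr v
  have h2 := tw_dvd hvt hr v
  generalize (tw G v).card = t at *
  have : t ≤ 2 := by omega
  interval_cases t <;> omega

theorem twins6 {G : SimpleGraph V} (hconn : G.Connected) (hvt : VertexTransitive G)
    (hnb : ¬ G.Colorable 2) (hr : Rg G 6) (hG : TF G) (heven : Even (Fintype.card V)) (v : V) :
    (tw G v).card ≤ 2 := by
  by_contra hc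
  have h1 := tw_lt hvt hnb hr v
  have h3 : (tw G v).card = 3 := by omega
  have hall : ∀ u, (tw G u).card = 3 := fun u => (tw_card hvt u v).trans h3
  obtain ⟨g, w, hw⟩ := exists_minOdd hnb
  have h5 := hw.five_le hG
  have hlow := sum_walk_deg hr hw h5
  have hN : ∀ i z, G.Adj (w (i + 1)) z → z ∈ tw G (w i) ∨ z ∈ tw G (w (i + 2)) := by
    intro i z hz
    obtain ⟨N, hN, hmem⟩ := nbr_card hr (w (i + 1))
    have hsub : tw G (w (i + 2)) ∪ tw G (w i) ⊆ N := by
      intro x hx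
      rw [hmem]
      rcases Finset.mem_union.1 hx with h | h
      · exact tw_sub (hw.1.1 (i + 1)) h
      · exact tw_sub (hw.1.1 i).symm h
    have heq := Finset.eq_of_subset_of_card_le hsub (by
      rw [Finset.card_union_of_disjoint (tw_disj (hw.not_tw i)), hall, hall, hN])
    have := (hmem z).2 hz
    rw [← heq, Finset.mem_union] at this
    tauto
  set T := (Finset.range g).biUnion (fun i => tw G (w i)) with hT
  have hwmod : ∀ i, w i = w (i % g) := by
    intro i
    induction i using Nat.strong_induction_on with
    | _ i ih =>
      rcases Nat.lt_or_ge i g with hl | hl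
      · rw [Nat.mod_eq_of_lt hl]
      · have e : w i = w (i - g) := by
          have := hw.1.2 (i - g); rwa [Nat.sub_add_cancel hl] at this
        rw [e, ih (i - g) (by omega), Nat.mod_eq_sub_mod hl]
  have hTmem : ∀ i x, x ∈ tw G (w i) → x ∈ T := by
    intro i x hx
    rw [hT, Finset.mem_biUnion]
    exact ⟨i % g, Finset.mem_range.2 (Nat.mod_lt _ (by omega)), by rw [← hwmod]; exact hx⟩
  have hclosed : ∀ x z, x ∈ T → G.Adj x z → z ∈ T := by
    intro x z hx hxz
    rw [hT, Finset.mem_biUnion] at hx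
    obtain ⟨i, _, hi⟩ := hx
    have hz : G.Adj (w i) z := (mem_tw.1 hi z).1 hxz
    rw [← hw.1.2 i, show i + g = (i + g - 1) + 1 by omega] at hz
    rcases hN _ _ hz with h | h <;> exact hTmem _ _ h
  have huniv : T = Finset.univ := by
    refine Finset.eq_univ_iff_forall.2 fun x => ?_
    obtain ⟨p⟩ := hconn.preconnected (w 0) x
    have : ∀ {a b : V} (p : G.Walk a b), a ∈ T → b ∈ T := by
      intro a b p
      induction p with
      | nil => exact id
      | cons hab _ ih => exact fun ha => ih (hclosed _ _ ha hab)
    exact this p (hTmem 0 _ (mem_tw.2 fun z => Iff.rfl))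
  have hup : Fintype.card V ≤ 3 * g := by
    rw [← Finset.card_univ, ← huniv, hT]
    refine Finset.card_biUnion_le.trans ?_
    rw [Finset.sum_congr rfl fun i _ => hall (w i)]
    simp [mul_comm]
  have hodd := hw.2.1
  rw [Nat.odd_iff] at hodd
  rw [Nat.even_iff] at heven
  omega

end VT

set_option linter.unusedSectionVars false

namespace VT
variable {V : Type*}

/-- the graph with only the edges inside `H` -/
def res (G : SimpleGraph V) (H : Finset V) : SimpleGraph V where
  Adj u v := G.Adj u v ∧ u ∈ H ∧ v ∈ H
  symm := ⟨fun _ _ h => ⟨h.1.symm, h.2.2, h.2.1⟩⟩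
  loopless := ⟨fun _ h => G.loopless.irrefl _ h.1⟩

lemma res_adj {G : SimpleGraph V} {H : Finset V} {u v : V} :
    (res G H).Adj u v ↔ G.Adj u v ∧ u ∈ H ∧ v ∈ H := Iff.rfl

variable [DecidableEq V] [Fintype V]

/-- the configuration with exactly one nontrivial component -/
structure Core (G : SimpleGraph V) (X I H : Finset V) : Prop where
  dXI : Disjoint X I
  dXH : Disjoint X H
  dIH : Disjoint I H
  un : X ∪ I ∪ H = Finset.univ
  nI : ∀ i ∈ I, ∀ u, G.Adj i u → u ∈ X
  nH : ∀ i ∈ H, ∀ u, G.Adj i u → u ∈ X ∨ u ∈ H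
  card : I.card + 3 = X.card
  odd : Odd H.card
  nc : ¬ (res G H).Colorable 2
  x4 : 4 ≤ X.card

variable {G : SimpleGraph V} {X I H : Finset V} {k : ℕ}

lemma Core.cardV (c : Core G X I H) : Fintype.card V + 3 = 2 * X.card + H.card := by
  have h1 : (X ∪ I ∪ H).card = X.card + I.card + H.card := by
    rw [Finset.card_union_of_disjoint (Finset.disjoint_union_left.2 ⟨c.dXH, c.dIH⟩),
      Finset.card_union_of_disjoint c.dXI]
  rw [c.un, Finset.card_univ] at h1
  have := c.card
  omega

lemma Core.eeIX (c : Core G X I H) (hr : Rg G k) : ee G I X = k * I.card := by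
  have h1 := ee_split hr I X
  have h2 : ee G I Xᶜ = 0 := ee_zero fun i hi u hu h => (Finset.mem_compl.1 hu) (c.nI i hi u h)
  omega

lemma Core.eeIA (c : Core G X I H) {A : Finset V} (hA : Disjoint X A) : ee G A I = 0 :=
  ee_zero fun a ha i hi h => Finset.disjoint_left.1 hA (c.nI i hi a h.symm) ha

lemma Core.bdH (c : Core G X I H) : bd G H = ee G H X := by
  have h1 : Hᶜ = X ∪ I := by
    ext u
    have hu : u ∈ X ∪ I ∪ H := by rw [c.un]; exact Finset.mem_univ _
    simp only [Finset.mem_union, Finset.mem_compl] at *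
    constructor
    · tauto
    · rintro (h | h) h'
      · exact Finset.disjoint_left.1 c.dXH h h'
      · exact Finset.disjoint_left.1 c.dIH h h'
  unfold bd
  rw [h1, ee_union_right G _ c.dXI, c.eeIA c.dXH, add_zero]

lemma Core.count (c : Core G X I H) (hr : Rg G k) : bd G H + ee G X X = 3 * k := by
  have h1 := ee_univ hr X
  rw [← c.un, ee_union_right G _ (Finset.disjoint_union_left.2 ⟨c.dXH, c.dIH⟩),
    ee_union_right G _ c.dXI, ee_comm G X I, ee_comm G X H, ← c.bdH, c.eeIX hr, ← c.card] at h1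
  have e : k * (I.card + 3) = k * I.card + 3 * k := by ring
  omega

lemma Core.x_ge (c : Core G X I H) (hr : Rg G k) : k ≤ X.card := by
  have h0 : I.Nonempty := by
    rw [← Finset.card_pos]; have := c.card; have := c.x4; omega
  obtain ⟨i, hi⟩ := h0
  rw [← hr i, ← Finset.union_compl X, dg_union G i disjoint_compl_right,
    dg_zero (A := Xᶜ) fun u hu h => (Finset.mem_compl.1 hu) (c.nI i hi u h)]
  exact dg_le_card _ _ _

lemma Core.cycle (c : Core G X I H) (hr : Rg G k) (hG : TF G) :
    ∃ (g : ℕ) (w : ℕ → V) (C : Finset V), MinOdd (res G H) g w ∧ 5 ≤ g ∧ Odd g ∧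
      C = (Finset.range g).image w ∧ C ⊆ H ∧ C.card = g ∧ CW G g w ∧
      (∀ u ∈ H, dg G u C = ∑ i ∈ Finset.range g, ad G u (w i)) ∧
      (∀ u ∈ H, dg G u C ≤ 2) ∧
      (∀ A, A ⊆ H → ee G A C ≤ 2 * A.card) ∧
      ee G C C + 2 * ee G (H \ C) C + bd G H = g * k + bd G (H \ C) := by
  obtain ⟨g, w, hw⟩ := exists_minOdd c.nc
  have hTF : TF (res G H) := fun a b d h1 h2 h3 => hG a b d h1.1 h2.1 h3.1
  have hg := hw.five_le hTF
  have hwH : ∀ i, w i ∈ H := fun i => (hw.1.1 i).2.1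
  have hCH : (Finset.range g).image w ⊆ H := by
    intro u hu
    obtain ⟨i, _, rfl⟩ := Finset.mem_image.1 hu
    exact hwH i
  have hdg : ∀ u ∈ H, dg G u ((Finset.range g).image w) = ∑ i ∈ Finset.range g, ad G u (w i) :=
    fun u _ => Finset.sum_image hw.inj
  have hdg2 : ∀ u ∈ H, dg G u ((Finset.range g).image w) ≤ 2 := by
    intro u hu
    rw [hdg u hu]
    refine le_trans (le_of_eq ?_) (hw.le_two hg u)
    refine Finset.sum_congr rfl fun i _ => ?_
    by_cases h : G.Adj u (w i)
    · rw [ad_pos h, ad_pos (G := res G H) ⟨h, hu, hwH i⟩]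
    · rw [ad_zero h, ad_zero (G := res G H) fun h' => h h'.1]
  refine ⟨g, w, _, hw, hg, hw.2.1, rfl, hCH, ?_, ⟨fun i => (hw.1.1 i).1, hw.1.2⟩, hdg, hdg2,
    ?_, ?_⟩
  · rw [Finset.card_image_of_injOn hw.inj, Finset.card_range]
  · intro A hA
    unfold ee
    refine (Finset.sum_le_sum fun u hu => hdg2 u (hA hu)).trans ?_
    simp [mul_comm]
  · have hc : ((Finset.range g).image w).card = g := by
      rw [Finset.card_image_of_injOn hw.inj, Finset.card_range]
    generalize (Finset.range g).image w = C at *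
    have hCU : C ∪ (H \ C) = H := Finset.union_sdiff_of_subset hCH
    have hd : Disjoint C (H \ C) := Finset.disjoint_sdiff
    have h1 := ee_univ hr C
    rw [← c.un, ee_union_right G _ (Finset.disjoint_union_left.2 ⟨c.dXH, c.dIH⟩),
      ee_union_right G _ c.dXI, c.eeIA (c.dXH.mono_right hCH), hc] at h1
    have h2 : ee G C H = ee G C C + ee G C (H \ C) := by
      rw [← ee_union_right G _ hd, hCU]
    have h3 : bd G H = ee G C X + ee G (H \ C) X := by
      rw [c.bdH, ← ee_union_left G _ hd, hCU]
    have h4 := bd_add hr (H \ C)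
    have h5 := ee_univ hr (H \ C)
    rw [← c.un, ee_union_right G _ (Finset.disjoint_union_left.2 ⟨c.dXH, c.dIH⟩),
      ee_union_right G _ c.dXI, c.eeIA (c.dXH.mono_right Finset.sdiff_subset)] at h5
    have h6 : ee G (H \ C) H = ee G (H \ C) C + ee G (H \ C) (H \ C) := by
      rw [← ee_union_right G _ hd, hCU]
    rw [ee_comm G C (H \ C)] at h2
    rw [mul_comm g k]
    omega

lemma ite_pair {p q : Prop} [Decidable p] [Decidable q] (h : ¬ (p ∧ q)) :
    (if p then 1 else 0) + (if q then 1 else 0) ≤ 1 := by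
  split_ifs <;> simp_all

lemma Core.F1 (c : Core G X I H) (hvt : VertexTransitive G) {w : ℕ → V} (hw : CW G 5 w)
    (h0 : ee G X X = 0) : 3 * X.card ≤ H.card + 12 := by
  have key := averaging hvt I (g := 5) (m := 1) (w := w) (fun φ => by
    have hv := hw.map φ
    set v := fun i => φ (w i) with hvdef
    have hP1 : ∀ i, ¬ (v i ∈ I ∧ v (i + 1) ∈ I) := fun i h =>
      Finset.disjoint_left.1 c.dXI (c.nI _ h.1 _ (hv.1 i)) h.2
    have hP2 : ∀ i, ¬ (v i ∈ I ∧ v (i + 2) ∈ I) := fun i h => by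
      have h3 := c.nI _ h.2 _ (hv.1 (i + 2))
      have h5 : v (i + 5) ∈ I := by rw [hv.2]; exact h.1
      have h4 := c.nI _ h5 _ (hv.1 (i + 4)).symm
      exact not_adj_of_ee h0 _ h3 _ h4 (hv.1 (i + 3))
    have e5 : v 5 = v 0 := hv.2 0
    have e6 : v 6 = v 1 := hv.2 1
    change ∑ i ∈ Finset.range 5, (if v i ∈ I then 1 else 0) ≤ 1
    have q1 := fun i => ite_pair (hP1 i)
    have q2 := fun i => ite_pair (hP2 i)
    generalize hf : (fun i => if v i ∈ I then 1 else 0) = f at *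
    have hf' : ∀ i, (if v i ∈ I then 1 else 0) = f i := fun i => congrFun hf i
    simp only [hf'] at q1 q2
    have f5 : f 5 = f 0 := by rw [← hf', ← hf', e5]
    have f6 : f 6 = f 1 := by rw [← hf', ← hf', e6]
    have a0 := q1 0
    have a1 := q1 1
    have a2 := q1 2
    have a3 := q1 3
    have a4 := q1 4
    have b0 := q2 0
    have b1 := q2 1
    have b2 := q2 2
    have b3 := q2 3
    have b4 := q2 4
    norm_num at a0 a1 a2 a3 a4 b0 b1 b2 b3 b4
    simp only [Finset.sum_range_succ, Finset.sum_range_zero]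
    omega)
  have := c.cardV
  have := c.card
  omega

end VT

set_option linter.unusedSectionVars false

namespace VT
variable {V : Type*} [DecidableEq V] [Fintype V]
variable {G : SimpleGraph V} {X I H : Finset V} {k : ℕ}

lemma Core.dgI (c : Core G X I H) (hr : Rg G k) {i : V} (hi : i ∈ I) : dg G i X = k := by
  rw [← hr i, ← Finset.union_compl X, dg_union G i disjoint_compl_right,
    dg_zero (A := Xᶜ) fun u hu h => (Finset.mem_compl.1 hu) (c.nI i hi u h), add_zero]

lemma Core.twins (c : Core G X I H) (hr : Rg G k) (hx : X.card = k) :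
    ∃ i, I.card ≤ (tw G i).card := by
  have h0 : I.Nonempty := by
    rw [← Finset.card_pos]; have := c.card; have := c.x4; omega
  obtain ⟨i, hi⟩ := h0
  refine ⟨i, Finset.card_le_card fun j hj => ?_⟩
  rw [mem_tw]
  have hi' := dg_full ((c.dgI hr hi).trans hx.symm)
  have hj' := dg_full ((c.dgI hr hj).trans hx.symm)
  exact fun z => ⟨fun h => hi' z (c.nI j hj z h), fun h => hj' z (c.nI i hi z h)⟩

lemma Core.K33 (c : Core G X I H) (hr : Rg G 5) (hG : TF G) {s : ℕ} (hs : s = 5 ∨ s = 6)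
    (hl : 13 ≤ lambdaS G s) (hH : s ≤ H.card) : X.card ≠ 6 := by
  intro hx
  classical
  have hI : I.card = 3 := by have := c.card; omega
  set Y := X.filter (fun y => dg G y I = 3) with hY
  have hYX : Y ⊆ X := Finset.filter_subset _ _
  have h1 : ee G X I = 15 := by rw [ee_comm, c.eeIX hr, hI]
  have h2 : ee G X I ≤ 2 * X.card + Y.card := by
    rw [hY, Finset.card_filter, mul_comm, ← smul_eq_mul, ← Finset.sum_const,
      ← Finset.sum_add_distrib]
    refine Finset.sum_le_sum fun y _ => ?_
    have := dg_le_card G y I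
    split_ifs <;> omega
  have h3 : ee G Y I = 3 * Y.card := by
    unfold ee
    rw [Finset.sum_congr rfl fun y hy => (Finset.mem_filter.1 hy).2]
    rw [Finset.sum_const, smul_eq_mul, mul_comm]
  have hd : Disjoint I Y := (c.dXI.mono_left hYX).symm
  have h4 := bd_add hr (I ∪ Y)
  rw [ee_union_left G _ hd, ee_union_right G _ hd, ee_union_right G _ hd, ee_comm G I Y, h3,
    Finset.card_union_of_disjoint hd, hI] at h4
  have hAc : H ⊆ (I ∪ Y)ᶜ := by
    intro u hu
    simp only [Finset.mem_compl, Finset.mem_union, not_or]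
    exact ⟨fun h => Finset.disjoint_left.1 c.dIH h hu,
      fun h => Finset.disjoint_left.1 c.dXH (hYX h) hu⟩
  have h5 := Finset.card_le_card hAc
  have h6 : (I ∪ Y).card = 3 + Y.card := by rw [Finset.card_union_of_disjoint hd, hI]
  have h7 := lam hr hG s (by omega) (by omega) _ (I ∪ Y) rfl (by omega) (by omega)
  rcases hs with rfl | rfl <;> norm_num at h7 <;> omega

lemma Core.ge5 (c : Core G X I H) (hG : TF G) : 5 ≤ H.card := by
  obtain ⟨g, w, hw⟩ := exists_minOdd c.nc
  have hTF : TF (res G H) := fun a b d h1 h2 h3 => hG a b d h1.1 h2.1 h3.1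
  have hg := hw.five_le hTF
  refine hg.trans ?_
  rw [← Finset.card_range g, ← Finset.card_image_of_injOn hw.inj]
  refine Finset.card_le_card fun u hu => ?_
  obtain ⟨i, _, rfl⟩ := Finset.mem_image.1 hu
  exact (hw.1.1 i).2.1

theorem Core.partB (c : Core G X I H) (hr : Rg G k) (hG : TF G) (hconn : G.Connected)
    (hvt : VertexTransitive G) (hnb : ¬ G.Colorable 2) (heven : Even (Fintype.card V))
    (hk : 5 ≤ k) (hk' : k ≤ 6) (hl : 4 * k - 8 < lambdaS G 5) :
    7 ≤ X.card ∧ 9 ≤ H.card := by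
  have hx := c.x_ge hr
  have hcard := c.card
  have hodd := c.odd
  have hcnt := c.count hr
  obtain ⟨g, w, C, hw, hg, hgo, hCdef, hCH, hCc, hCW, -, -, hA, hE⟩ := c.cycle hr hG
  have hu : (H \ C).card + g = H.card := by
    rw [Finset.card_sdiff_of_subset hCH, hCc]
    have := Finset.card_le_card hCH
    omega
  have hCC := hA C hCH
  have hUC := hA (H \ C) Finset.sdiff_subset
  have hm := bd_mantel hr hG (H \ C)
  have ht : ee G (H \ C) C ≤ bd G (H \ C) := ee_mono G (subset_refl _) (by
    intro z hz; simp [hz])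
  obtain ⟨r, hr'⟩ := hgo
  obtain ⟨q, hq⟩ := hodd
  rw [hCc] at hCC
  have hk2 : k = 5 ∨ k = 6 := by omega
  rcases hk2 with rfl | rfl
  · have hx6 : X.card ≠ 5 := by
      intro h
      obtain ⟨i, hi⟩ := c.twins hr h
      have := twins5 hvt hnb hr i
      omega
    have hx7 : X.card ≠ 6 := c.K33 hr hG (Or.inl rfl) (by omega) (c.ge5 hG)
    refine ⟨by omega, ?_⟩
    by_contra hlt
    have hg57 : g = 5 ∨ g = 7 := by omega
    rcases hg57 with rfl | rfl
    · have hu2 : (H \ C).card = 0 ∨ (H \ C).card = 2 := by omega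
      have h0 : ee G X X = 0 := by
        rcases hu2 with hu2 | hu2 <;> rw [hu2] at hm <;> omega
      have := c.F1 hvt hCW h0
      omega
    · omega
  · have hx7 : X.card ≠ 6 := by
      intro h
      obtain ⟨i, hi⟩ := c.twins hr h
      have := twins6 hconn hvt hnb hr hG heven i
      omega
    refine ⟨by omega, ?_⟩
    by_contra hlt
    have hg57 : g = 5 ∨ g = 7 := by omega
    rcases hg57 with rfl | rfl
    · have hu2 : (H \ C).card = 0 ∨ (H \ C).card = 2 := by omega
      rcases hu2 with hu2 | hu2 <;> rw [hu2] at hm <;> omega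
    · omega

end VT

set_option linter.unusedSectionVars false

namespace VT
variable {V : Type*} [DecidableEq V] [Fintype V]
variable {G : SimpleGraph V} {X I H : Finset V} {k : ℕ}

/-- the set of all neighbours of vertices of `S` -/
noncomputable def NN (G : SimpleGraph V) (S : Finset V) : Finset V := by
  classical exact Finset.univ.filter (fun u => ∃ v ∈ S, G.Adj v u)

lemma mem_NN {S : Finset V} {u : V} : u ∈ NN G S ↔ ∃ v ∈ S, G.Adj v u := by
  simp [NN]

lemma NN_mono {S T : Finset V} (h : S ⊆ T) : NN G S ⊆ NN G T := by
  intro u hu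
  rw [mem_NN] at *
  obtain ⟨v, hv, hvu⟩ := hu
  exact ⟨v, h hv, hvu⟩

lemma NN_union (S T : Finset V) : NN G (S ∪ T) = NN G S ∪ NN G T := by
  ext u
  simp only [mem_NN, Finset.mem_union]
  constructor
  · rintro ⟨v, hv | hv, h⟩
    · exact Or.inl ⟨v, hv, h⟩
    · exact Or.inr ⟨v, hv, h⟩
  · rintro (⟨v, hv, h⟩ | ⟨v, hv, h⟩)
    · exact ⟨v, Or.inl hv, h⟩
    · exact ⟨v, Or.inr hv, h⟩

lemma NN_image (φ : G ≃g G) (S : Finset V) : NN G (S.image φ) = (NN G S).image φ := by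
  ext u
  simp only [mem_NN, Finset.mem_image]
  constructor
  · rintro ⟨v, ⟨s, hs, rfl⟩, h⟩
    refine ⟨φ.symm u, ⟨s, hs, ?_⟩, by simp⟩
    rw [← φ.map_adj_iff]; simpa using h
  · rintro ⟨v, ⟨s, hs, h⟩, rfl⟩
    exact ⟨φ s, ⟨s, hs, rfl⟩, φ.map_adj_iff.2 h⟩

lemma dg_image (φ : G ≃g G) (S : Finset V) (y : V) : dg G (φ y) (S.image φ) = dg G y S := by
  unfold dg
  rw [Finset.sum_image φ.injective.injOn]
  refine Finset.sum_congr rfl fun u _ => ?_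
  by_cases h : G.Adj y u
  · rw [ad_pos h, ad_pos (φ.map_adj_iff.2 h)]
  · rw [ad_zero h, ad_zero (fun h' => h (φ.map_adj_iff.1 h'))]

lemma ee_NN (hr : Rg G k) (S : Finset V) : ee G S (NN G S) = k * S.card := by
  have h1 := ee_split hr S (NN G S)
  have h2 : ee G S (NN G S)ᶜ = 0 :=
    ee_zero fun i hi u hu h => (Finset.mem_compl.1 hu) (mem_NN.2 ⟨i, hi, h⟩)
  omega

lemma bd_NN (hr : Rg G k) (S : Finset V) :
    bd G (S ∪ NN G S) + k * S.card ≤ k * (NN G S).card := by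
  have h0 : ee G (NN G S) (S ∪ NN G S)ᶜ + ee G (NN G S) S ≤ k * (NN G S).card := by
    rw [← ee_univ hr, ← ee_union_right]
    · exact ee_mono G (subset_refl _) (Finset.subset_univ _)
    · rw [Finset.disjoint_left]
      intro u hu hu'
      simp [hu'] at hu
  have h1 : bd G (S ∪ NN G S) ≤ ee G (NN G S) (S ∪ NN G S)ᶜ := by
    unfold bd
    rw [← Finset.sdiff_union_self_eq_union, ee_union_left G _ Finset.sdiff_disjoint,
      Finset.sdiff_union_self_eq_union]
    have : ee G (S \ NN G S) (S ∪ NN G S)ᶜ = 0 := by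
      refine ee_zero fun i hi u hu h => ?_
      have h2 : u ∈ NN G S := mem_NN.2 ⟨i, (Finset.mem_sdiff.1 hi).1, h⟩
      simp [h2] at hu
    omega
  rw [ee_comm G (NN G S) S, ee_NN hr] at h0
  omega

lemma card_NN_ge (hr : Rg G k) {S : Finset V} (hS : S.Nonempty) :
    k ≤ (NN G S).card ∧ k + 1 ≤ (S ∪ NN G S).card := by
  obtain ⟨v, hv⟩ := hS
  obtain ⟨N, hN, hm⟩ := nbr_card hr v
  have h1 : N ⊆ NN G S := fun u hu => mem_NN.2 ⟨v, hv, (hm u).1 hu⟩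
  constructor
  · rw [← hN]; exact Finset.card_le_card h1
  · have h2 : v ∉ N := fun h => G.loopless.irrefl v ((hm v).1 h)
    rw [← hN, ← Finset.card_insert_of_notMem h2]
    refine Finset.card_le_card (Finset.insert_subset (Finset.mem_union_left _ hv) ?_)
    exact h1.trans Finset.subset_union_right

lemma f_lemma (hr : Rg G 5) (hG : TF G) (hl : 14 ≤ lambdaS G 6) {S : Finset V}
    (hS : S.Nonempty) (hc : 3 ≤ (S ∪ NN G S)ᶜ.card) : S.card + 3 ≤ (NN G S).card := by
  by_contra hlt
  have h1 := bd_NN hr S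
  have h2 := (card_NN_ge hr hS).2
  have hb : bd G (S ∪ NN G S) ≤ 10 := by omega
  by_cases h6 : 6 ≤ (S ∪ NN G S)ᶜ.card
  · have := lam hr hG 6 (by omega) (by omega) _ _ rfl h2 h6
    omega
  · have hm := bd_mantel hr hG (S ∪ NN G S)ᶜ
    rw [bd_compl] at hm
    have h3 : (S ∪ NN G S)ᶜ.card = 3 ∨ (S ∪ NN G S)ᶜ.card = 4 ∨ (S ∪ NN G S)ᶜ.card = 5 := by omega
    rcases h3 with h3 | h3 | h3 <;> rw [h3] at hm <;> omega

theorem Core.block (c : Core G X I H) (hr : Rg G 5) (hG : TF G)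
    (hvt : VertexTransitive G) (hnb : ¬ G.Colorable 2) (hl : 14 ≤ lambdaS G 6)
    (hx : X.card ≤ 9) (hh : 9 ≤ H.card) (hh' : 2 * X.card ≤ H.card + 6) : False := by
  classical
  have hcV := c.cardV
  have hcI := c.card
  have hI0 : I.Nonempty := by
    rw [← Finset.card_pos]; have := c.x4; omega
  have hNX : ∀ S, S ⊆ I → NN G S ⊆ X := by
    intro S hS u hu
    obtain ⟨v, hv, h⟩ := mem_NN.1 hu
    exact c.nI v (hS hv) u h
  -- minimal set
  obtain ⟨S, hSm, hmin⟩ := Finset.exists_min_image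
    (I.powerset.filter fun S => S.Nonempty ∧ (NN G S).card ≤ S.card + 3) (fun S => S.card)
    ⟨I, by
      rw [Finset.mem_filter, Finset.mem_powerset]
      exact ⟨subset_refl _, hI0, (Finset.card_le_card (hNX I (subset_refl _))).trans
        (le_of_eq hcI.symm)⟩⟩
  rw [Finset.mem_filter, Finset.mem_powerset] at hSm
  obtain ⟨hSI, hS0, hSN⟩ := hSm
  have hmin' : ∀ B, B ⊆ I → B.Nonempty → B.card < S.card → B.card + 4 ≤ (NN G B).card := by
    intro B hB hB0 hlt
    by_contra hcon
    have := hmin B (by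
      rw [Finset.mem_filter, Finset.mem_powerset]
      exact ⟨hB, hB0, by omega⟩)
    omega
  have hsI := Finset.card_le_card hSI
  have hHc : ∀ A, A ⊆ I ∪ X → H ⊆ Aᶜ := by
    intro A hA u hu
    rw [Finset.mem_compl]
    intro h
    rcases Finset.mem_union.1 (hA h) with h | h
    · exact Finset.disjoint_left.1 c.dIH h hu
    · exact Finset.disjoint_left.1 c.dXH h hu
  have hSNI : S ∪ NN G S ⊆ I ∪ X := Finset.union_subset_union hSI (hNX S hSI)
  have hSN' : S.card + 3 ≤ (NN G S).card :=
    f_lemma hr hG hl hS0 (by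
      have := Finset.card_le_card (hHc _ hSNI)
      omega)
  have hSNe : (NN G S).card = S.card + 3 := le_antisymm hSN hSN'
  -- block property
  have hblock : ∀ φ : G ≃g G, S.image φ = S ∨ Disjoint S (S.image φ) := by
    intro φ
    by_contra hcon
    push Not at hcon
    obtain ⟨hne, hnd⟩ := hcon
    have hci : (S.image φ).card = S.card := Finset.card_image_of_injective _ φ.injective
    have hB0 : (S ∩ S.image φ).Nonempty := by
      rw [Finset.nonempty_iff_ne_empty]
      intro h
      exact hnd (Finset.disjoint_iff_inter_eq_empty.2 h)
    have hBlt : (S ∩ S.image φ).card < S.card := by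
      refine Finset.card_lt_card (Finset.ssubset_iff_subset_ne.2 ⟨Finset.inter_subset_left, ?_⟩)
      intro h
      have h2 : S ⊆ S.image φ := by
        intro z hz
        rw [← h] at hz
        exact (Finset.mem_inter.1 hz).2
      exact hne (Finset.eq_of_subset_of_card_le h2 (le_of_eq hci)).symm
    have hBS : S ∩ S.image φ ⊆ S := Finset.inter_subset_left
    have hB := hmin' _ (hBS.trans hSI) hB0 hBlt
    have hBN : NN G (S ∩ S.image φ) ⊆ NN G S ∩ NN G (S.image φ) :=
      Finset.subset_inter (NN_mono Finset.inter_subset_left) (NN_mono Finset.inter_subset_right)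
    have h1 := Finset.card_le_card hBN
    have h2 := Finset.card_union_add_card_inter (NN G S) (NN G (S.image φ))
    have h3 := Finset.card_union_add_card_inter S (S.image φ)
    have h4 : (NN G (S.image φ)).card = S.card + 3 := by
      rw [NN_image, Finset.card_image_of_injective _ φ.injective, hSNe]
    rw [← NN_union] at h2
    have h5 := Finset.card_union_le (S ∪ S.image φ) (NN G (S ∪ S.image φ))
    have h6 := Finset.card_add_card_compl ((S ∪ S.image φ) ∪ NN G (S ∪ S.image φ))
    have hB1 := Finset.card_pos.2 hB0
    have h7 := f_lemma hr hG hl (S := S ∪ S.image φ)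
      (hS0.mono Finset.subset_union_left) (by omega)
    omega
  have h5 := (card_NN_ge hr hS0).1
  have hdSN : Disjoint S (NN G S) := (c.dXI.mono (hNX S hSI) hSI).symm
  -- s = 2
  have hs2 : S.card ≠ 2 := by
    intro h2
    obtain ⟨i, hi⟩ := hS0
    have hN : ∀ j ∈ S, ∀ z, G.Adj j z ↔ z ∈ NN G S := by
      intro j hj z
      obtain ⟨N, hN, hm⟩ := nbr_card hr j
      have h1 : N ⊆ NN G S := fun u hu => mem_NN.2 ⟨j, hj, (hm u).1 hu⟩
      have h3 := Finset.eq_of_subset_of_card_le h1 (by omega)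
      rw [← h3, hm]
    have h3 : S ⊆ tw G i := fun j hj => mem_tw.2 fun z => (hN j hj z).trans (hN i hi z).symm
    have h4 := Finset.card_le_card h3
    have h6 := twins5 hvt hnb hr i
    omega
  have hs3 : 3 ≤ S.card := by omega
  -- at most one low vertex
  have hlow1 : ∀ y ∈ NN G S, ∀ y' ∈ NN G S, dg G y S ≤ 2 → dg G y' S ≤ 2 → y = y' := by
    intro y hy y' hy' hd hd'
    by_contra hne
    set P : Finset V := {y, y'} with hP
    have hPc : P.card = 2 := Finset.card_pair hne
    have hPN : P ⊆ NN G S := by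
      intro z hz
      rw [hP, Finset.mem_insert, Finset.mem_singleton] at hz
      rcases hz with rfl | rfl <;> assumption
    have hPS : ee G P S ≤ 4 := by
      unfold ee
      rw [hP, Finset.sum_pair hne]
      omega
    have e1 : ee G S (NN G S \ P) + ee G S P = 5 * S.card := by
      rw [← ee_union_right G _ Finset.sdiff_disjoint, Finset.sdiff_union_of_subset hPN, ee_NN hr]
    have hdd : Disjoint S (NN G S \ P) := hdSN.mono_right Finset.sdiff_subset
    have e2 := bd_add hr (S ∪ (NN G S \ P))
    have e3 : (S ∪ (NN G S \ P)).card = 2 * S.card + 1 := by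
      rw [Finset.card_union_of_disjoint hdd, Finset.card_sdiff_of_subset hPN, hPc, hSNe]
      omega
    rw [ee_union_left G _ hdd, ee_union_right G _ hdd, ee_union_right G _ hdd,
      ee_comm G (NN G S \ P) S, e3] at e2
    rw [ee_comm G P S] at hPS
    have e4 := Finset.card_le_card (hHc (S ∪ (NN G S \ P))
      ((Finset.union_subset_union (subset_refl _) Finset.sdiff_subset).trans hSNI))
    have e5 := lam hr hG 6 (by omega) (by omega) _ (S ∪ (NN G S \ P)) rfl (by omega) (by omega)
    omega
  have hlow0 : ∀ y ∈ NN G S, 3 ≤ dg G y S := by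
    intro y hy
    by_contra hlt
    obtain ⟨v, hv, hvy⟩ := mem_NN.1 hy
    have hall : ∀ u ∈ S, G.Adj y u := by
      intro u hu
      obtain ⟨φ, hφ⟩ := hvt v u
      have hSS : S.image φ = S := by
        rcases hblock φ with h | h
        · exact h
        · exact absurd (hφ ▸ Finset.mem_image_of_mem φ hv : u ∈ S.image φ)
            (Finset.disjoint_left.1 h hu)
      have h1 : φ y ∈ NN G S := by
        rw [← hSS, NN_image]; exact Finset.mem_image_of_mem _ hy
      have h2 : dg G (φ y) S = dg G y S := by
        conv_lhs => rw [← hSS]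
        exact dg_image φ S y
      have h3 := hlow1 _ h1 _ hy (by omega) (by omega)
      have h4 := φ.map_adj_iff.2 hvy
      rw [h3, hφ] at h4
      exact h4.symm
    have : dg G y S = S.card := by
      unfold dg
      rw [Finset.sum_congr rfl fun u hu => ad_pos (hall u hu)]
      simp
    omega
  have heq : ∀ y ∈ NN G S, ∀ y' ∈ NN G S, dg G y S = dg G y' S := by
    intro y hy y' hy'
    obtain ⟨φ, hφ⟩ := hvt y y'
    have h1 := dg_image φ S y
    rw [hφ] at h1
    rcases hblock φ with h | h
    · rw [h] at h1; exact h1.symm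
    · have h2 := dg_union G y' h
      have h3 := dg_mono G y' (Finset.subset_univ (S ∪ S.image φ))
      rw [hr y'] at h3
      have := hlow0 y hy
      have := hlow0 y' hy'
      omega
  have hNne : (NN G S).Nonempty := by rw [← Finset.card_pos]; omega
  obtain ⟨y, hy⟩ := hNne
  have hfin : ee G (NN G S) S = (S.card + 3) * dg G y S := by
    unfold ee
    rw [Finset.sum_congr rfl fun z hz => heq z hz y hy, Finset.sum_const, hSNe, smul_eq_mul]
  rw [ee_comm, ee_NN hr] at hfin
  have hs : S.card = 3 ∨ S.card = 4 ∨ S.card = 5 ∨ S.card = 6 := by omega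
  rcases hs with h | h | h | h <;> rw [h] at hfin <;> omega

end VT

set_option linter.unusedSectionVars false

namespace VT
variable {V : Type*} [DecidableEq V] [Fintype V]
variable {G : SimpleGraph V} {X I H : Finset V} {k : ℕ}

/-- vertices reachable by a walk of length two -/
noncomputable def W2 (R : SimpleGraph V) (v : V) : Finset V := by
  classical exact Finset.univ.filter (fun u => ∃ z, R.Adj v z ∧ R.Adj z u)

lemma mem_W2 {R : SimpleGraph V} {v u : V} : u ∈ W2 R v ↔ ∃ z, R.Adj v z ∧ R.Adj z u := by
  simp [W2]

lemma shift7 (a b : ℕ → ℕ) (ha : ∀ i, a i ≤ 1) (h1 : ∀ i, a i ≤ b (i + 1))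
    (h2 : ∀ i, a (i + 1) ≤ b i) (pa : ∀ i, a (i + 7) = a i) (pb : ∀ i, b (i + 7) = b i)
    (hs : ∑ i ∈ Finset.range 7, a i ≤ 2) :
    3 * ∑ i ∈ Finset.range 7, a i ≤ 2 * ∑ i ∈ Finset.range 7, b i := by
  simp only [Finset.sum_range_succ, Finset.sum_range_zero, zero_add] at *
  have pb7 := pb 0
  have pa7 := pa 0
  have x0 := ha 0
  have x1 := ha 1
  have x2 := ha 2
  have x3 := ha 3
  have x4 := ha 4
  have x5 := ha 5
  have x6 := ha 6
  have y0 := h1 0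
  have y1 := h1 1
  have y2 := h1 2
  have y3 := h1 3
  have y4 := h1 4
  have y5 := h1 5
  have y6 := h1 6
  have z0 := h2 0
  have z1 := h2 1
  have z2 := h2 2
  have z3 := h2 3
  have z4 := h2 4
  have z5 := h2 5
  have z6 := h2 6
  norm_num at *
  rw [pb7] at y6
  rw [pa7] at z6
  generalize a 0 = a0 at *
  generalize a 1 = a1 at *
  generalize a 2 = a2 at *
  generalize a 3 = a3 at *
  generalize a 4 = a4 at *
  generalize a 5 = a5 at *
  generalize a 6 = a6 at *
  clear ha h1 h2 pa pb pa7 pb7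
  interval_cases a0 <;> interval_cases a1 <;> omega

lemma Core.no7 (c : Core G X I H) (hr : Rg G 5) (hG : TF G) (hvt : VertexTransitive G)
    (hl : 14 ≤ lambdaS G 6) {w : ℕ → V} {C : Finset V} (hw : MinOdd (res G H) 7 w)
    (hC : C = (Finset.range 7).image w) (hCH : C ⊆ H) (hCc : C.card = 7) (hCW : CW G 7 w)
    (hd : ∀ u ∈ H, dg G u C = ∑ i ∈ Finset.range 7, ad G u (w i))
    (hA : ∀ A, A ⊆ H → ee G A C ≤ 2 * A.card)
    (hE : ee G C C + 2 * ee G (H \ C) C + bd G H = 7 * 5 + bd G (H \ C))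
    (hb : bd G H ≤ 15) (hh : H.card = 13) (hx : 10 ≤ X.card) : False := by
  classical
  have hcV := c.cardV
  have hcI := c.card
  have hwH : ∀ i, w i ∈ H := fun i => (hw.1.1 i).2.1
  have hu : (H \ C).card = 6 := by
    rw [Finset.card_sdiff_of_subset hCH, hCc, hh]
  have hCC := hA C hCH
  have hbU : 14 ≤ bd G (H \ C) := by
    have h1 := Finset.card_add_card_compl (H \ C)
    have h2 := lam hr hG 6 (by omega) (by omega) _ (H \ C) rfl (by omega) (by omega)
    omega
  have hCC2 : 14 ≤ ee G C C := by
    have h1 : ∀ u ∈ C, 2 ≤ dg G u C := by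
      intro u huC
      have huC' := huC
      rw [hC] at huC
      obtain ⟨i, hi, rfl⟩ := Finset.mem_image.1 huC
      rw [hd _ (hwH i)]
      have hi7 : i < 7 := Finset.mem_range.1 hi
      set p := (i + 1) % 7 with hp
      set q := (i + 6) % 7 with hq
      have hmod : ∀ j, w (j % 7) = w j := by
        intro j
        conv_rhs => rw [← Nat.mod_add_div j 7]
        generalize j % 7 = r
        generalize j / 7 = m
        induction m with
        | zero => rfl
        | succ m ih => rw [Nat.mul_succ, ← add_assoc, hw.1.2]; exact ih
      have hpq : p ≠ q := by omega
      have h3 : G.Adj (w i) (w p) := by rw [hp, hmod]; exact hCW.1 i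
      have h4 : G.Adj (w i) (w q) := by
        rw [hq, hmod, ← hCW.2 i]; exact (hCW.1 (i + 6)).symm
      have h5 : ∑ j ∈ ({p, q} : Finset ℕ), ad G (w i) (w j) = 2 := by
        rw [Finset.sum_pair hpq, ad_pos h3, ad_pos h4]
      rw [← h5]
      refine Finset.sum_le_sum_of_subset ?_
      intro j hj
      rw [Finset.mem_insert, Finset.mem_singleton] at hj
      rw [Finset.mem_range]
      omega
    have h2 := Finset.sum_le_sum h1
    rw [Finset.sum_const, hCc] at h2
    exact h2
  have hsum : ee G H C = ee G C C + ee G (H \ C) C := by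
    rw [← ee_union_left G _ Finset.disjoint_sdiff, Finset.union_sdiff_of_subset hCH]
  set R := res G H with hR
  have hadR : ∀ u ∈ H, ∀ i, ad R u (w i) = ad G u (w i) := by
    intro u hu i
    by_cases h : G.Adj u (w i)
    · rw [ad_pos h, ad_pos (G := R) ⟨h, hu, hwH i⟩]
    · rw [ad_zero h, ad_zero (G := R) fun h' => h h'.1]
  have hkey : ∀ u ∈ H, 3 * dg G u C ≤
      2 * ∑ i ∈ Finset.range 7, (if u ∈ W2 R (w i) then 1 else 0) := by
    intro u huH
    rw [hd u huH, ← Finset.sum_congr rfl fun i _ => hadR u huH i]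
    have hmono : ∀ i j, (R.Adj u (w i) → R.Adj (w j) (w i)) →
        ad R u (w i) ≤ if u ∈ W2 R (w j) then 1 else 0 := by
      intro i j hij
      by_cases h : R.Adj u (w i)
      · rw [if_pos (mem_W2.2 ⟨w i, hij h, h.symm⟩)]; exact ad_le _ _ _
      · rw [ad_zero h]; exact Nat.zero_le _
    refine shift7 (fun i => ad R u (w i)) (fun i => if u ∈ W2 R (w i) then 1 else 0)
      (fun i => ad_le _ _ _) (fun i => hmono _ _ fun _ => (hw.1.1 i).symm)
      (fun i => hmono _ _ fun _ => hw.1.1 i) (fun i => by simp only [hw.1.2])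
      (fun i => by simp only [hw.1.2]) (hw.le_two (by norm_num) u)
  have hW : ∀ i, ∑ u ∈ H, (if u ∈ W2 R (w i) then 1 else 0) = (W2 R (w i)).card := by
    intro i
    rw [← Finset.card_filter]
    congr 1
    ext u
    rw [Finset.mem_filter]
    refine ⟨fun h => h.2, fun h => ⟨?_, h⟩⟩
    obtain ⟨z, _, hz⟩ := mem_W2.1 h
    exact hz.2.2
  have htot : 3 * ee G H C ≤ 2 * ∑ i ∈ Finset.range 7, (W2 R (w i)).card := by
    rw [← Finset.sum_congr rfl fun i _ => hW i, Finset.sum_comm, Finset.mul_sum]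
    unfold ee
    rw [Finset.mul_sum]
    exact Finset.sum_le_sum hkey
  obtain ⟨i, hi⟩ : ∃ i, 6 ≤ (W2 R (w i)).card := by
    by_contra hcon
    push Not at hcon
    have : ∑ i ∈ Finset.range 7, (W2 R (w i)).card ≤ ∑ i ∈ Finset.range 7, 5 :=
      Finset.sum_le_sum fun i _ => by have := hcon i; omega
    simp only [Finset.sum_const, Finset.card_range, smul_eq_mul] at this
    omega
  have hWH : W2 R (w i) ⊆ H := by
    intro u hu
    obtain ⟨z, _, hz⟩ := mem_W2.1 hu
    exact hz.2.2
  have hIW : ∀ u ∈ I, ∀ v ∈ H, ¬ G.Adj u v := fun u hu v hv h =>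
    Finset.disjoint_left.1 c.dXH (c.nI u hu v h) hv
  have hind : ∀ u ∈ I ∪ W2 R (w i), ∀ v ∈ I ∪ W2 R (w i), ¬ G.Adj u v := by
    intro u hu v hv h
    rcases Finset.mem_union.1 hu with hu | hu <;> rcases Finset.mem_union.1 hv with hv | hv
    · exact Finset.disjoint_left.1 c.dXI (c.nI u hu v h) hv
    · exact hIW u hu v (hWH hv) h
    · exact hIW v hv u (hWH hu) h.symm
    · obtain ⟨z, h1, h2⟩ := mem_W2.1 hu
      obtain ⟨z', h1', h2'⟩ := mem_W2.1 hv
      have h3 : R.Adj u v := ⟨h, hWH hu, hWH hv⟩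
      have := hw.2.2 _ (Walk.cons h1 (Walk.cons h2 (Walk.cons h3 (Walk.cons h2'.symm
        (Walk.cons h1'.symm Walk.nil))))) (by simp only [Walk.length_cons, Walk.length_nil]; decide)
      simp only [Walk.length_cons, Walk.length_nil] at this
      omega
  have hav := averaging_indep hvt _ hCW (by decide) hind
  rw [Finset.card_union_of_disjoint (c.dIH.mono_right hWH)] at hav
  omega

theorem Core.partC (c : Core G X I H) (hr : Rg G 5) (hG : TF G)
    (hvt : VertexTransitive G) (hnb : ¬ G.Colorable 2) (hl : 14 ≤ lambdaS G 6) :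
    10 ≤ X.card ∧ 15 ≤ H.card := by
  have hx := c.x_ge hr
  have hcard := c.card
  have hcV := c.cardV
  have hodd := c.odd
  have hcnt := c.count hr
  have hge5 := c.ge5 hG
  obtain ⟨g, w, C, hw, hg, hgo, hCdef, hCH, hCc, hCW, hd, -, hA, hE⟩ := c.cycle hr hG
  have hu : (H \ C).card + g = H.card := by
    rw [Finset.card_sdiff_of_subset hCH, hCc]
    have := Finset.card_le_card hCH
    omega
  have hCC := hA C hCH
  have hUC := hA (H \ C) Finset.sdiff_subset
  have hm := bd_mantel hr hG (H \ C)
  have ht : ee G (H \ C) C ≤ bd G (H \ C) := ee_mono G (subset_refl _) (by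
    intro z hz; simp [hz])
  rw [hCc] at hCC
  have hbH : bd G H = 15 := by
    by_cases h5 : H.card = 5
    · omega
    · have h1 := Finset.card_add_card_compl H
      have h2 := lam hr hG 6 (by omega) (by omega) _ H rfl (by
        obtain ⟨q, hq⟩ := hodd; omega) (by omega)
      have h3 := bd_add hr H
      obtain ⟨a, ha⟩ := ee_self_even G H
      obtain ⟨q, hq⟩ := hodd
      omega
  have h0 : ee G X X = 0 := by omega
  obtain ⟨r, hr'⟩ := hgo
  obtain ⟨q, hq⟩ := hodd
  have hx6 : X.card ≠ 5 := by
    intro h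
    obtain ⟨i, hi⟩ := c.twins hr h
    have := twins5 hvt hnb hr i
    omega
  have hh5 : H.card ≠ 5 := by
    intro h
    have hg5 : g = 5 := by omega
    subst hg5
    have := c.F1 hvt hCW h0
    omega
  have hx7 : X.card ≠ 6 := c.K33 hr hG (Or.inr rfl) (by omega) (by omega)
  have hblock : X.card ≤ 9 → 9 ≤ H.card → 2 * X.card ≤ H.card + 6 → False :=
    fun h1 h2 h3 => c.block hr hG hvt hnb hl h1 h2 h3
  by_cases hg5 : g = 5
  · subst hg5
    have := c.F1 hvt hCW h0
    by_cases hx9 : X.card ≤ 9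
    · exact (hblock hx9 (by omega) (by omega)).elim
    · omega
  by_cases hg7 : g = 7
  · subst hg7
    have h11 : H.card ≠ 11 := by
      intro h
      have : (H \ C).card = 4 := by omega
      rw [this] at hm
      omega
    have hx10 : 10 ≤ X.card := by
      by_contra hx9
      exact hblock (by omega) (by omega) (by omega)
    refine ⟨hx10, ?_⟩
    by_contra hlt
    exact c.no7 hr hG hvt hl hw hCdef hCH hCc hCW hd hA hE (le_of_eq hbH) (by omega) hx10
  · have h15 : 15 ≤ H.card := by omega
    refine ⟨?_, h15⟩
    by_contra hx9
    exact hblock (by omega) (by omega) (by omega)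

end VT

set_option linter.unusedSectionVars false

namespace VT

lemma balance_le {W : Type*} [Fintype W] {F : SimpleGraph W} (M : F.Subgraph)
    (hM : M.IsPerfectMatching) (f : W → Fin 2) (hf : ∀ u v, F.Adj u v → f u ≠ f v) (a b : Fin 2)
    (hab : a ≠ b) :
    (Finset.univ.filter fun v => f v = a).card ≤ (Finset.univ.filter fun v => f v = b).card := by
  rw [Subgraph.isPerfectMatching_iff] at hM
  choose m hm hm' using hM
  refine Finset.card_le_card_of_injOn m ?_ ?_
  · intro u hu
    have hu2 : f u = a := by simpa using hu
    have := hf _ _ (M.adj_sub (hm u))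
    simp only [Finset.coe_filter, Finset.mem_univ, true_and, Set.mem_ofPred_eq]
    omega
  · intro u _ v _ h
    have h1 := hm' (m u) u (hm u).symm
    have h2 := hm' (m u) v (by rw [h]; exact (hm v).symm)
    exact h1.trans h2.symm

lemma fc_not_colorable {W : Type*} [Fintype W] {F : SimpleGraph W} (hF : IsFactorCritical F)
    (hc : 2 ≤ Fintype.card W) : ¬ F.Colorable 2 := by
  classical
  rintro ⟨f⟩
  -- counts
  have key : ∀ v : W, ∀ b, b ≠ f v → (Finset.univ.filter fun u => f u = f v).card =
      (Finset.univ.filter fun u => f u = b).card + 1 := by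
    intro v b hb
    obtain ⟨M, hM⟩ := hF v
    have h1 := balance_le M hM (fun u => f u.1) (fun u w h => f.valid h) (f v) b hb.symm
    have h2 := balance_le M hM (fun u => f u.1) (fun u w h => f.valid h) b (f v) hb
    have e : ∀ d, (Finset.univ.filter fun u : ({v}ᶜ : Set W) => f u.1 = d).card =
        ((Finset.univ.filter fun u => f u = d).erase v).card := by
      intro d
      refine Finset.card_bij (fun u _ => u.1) ?_ ?_ ?_
      · intro u hu
        have h3 : u.1 ≠ v := u.2
        simpa [h3] using hu
      · intro u _ w _ h
        exact Subtype.ext h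
      · intro u hu
        rw [Finset.mem_erase, Finset.mem_filter] at hu
        exact ⟨⟨u, hu.1⟩, by simpa using hu.2.2, rfl⟩
    rw [e, e] at h1 h2
    have e1 : ((Finset.univ.filter fun u => f u = f v).erase v).card =
        (Finset.univ.filter fun u => f u = f v).card - 1 := Finset.card_erase_of_mem (by simp)
    have e2 : (Finset.univ.filter fun u => f u = b).erase v =
        Finset.univ.filter fun u => f u = b := Finset.erase_eq_of_notMem (by simp [hb.symm])
    rw [e1, e2] at h1 h2
    have h3 : 0 < (Finset.univ.filter fun u => f u = f v).card :=
      Finset.card_pos.2 ⟨v, by simp⟩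
    omega
  have hne : Nonempty W := Fintype.card_pos_iff.1 (by omega)
  obtain ⟨v⟩ := hne
  obtain ⟨u, hu⟩ : ∃ u, u ≠ v := Fintype.exists_ne_of_one_lt_card (by omega) v
  obtain ⟨M, hM⟩ := hF v
  rw [Subgraph.isPerfectMatching_iff] at hM
  obtain ⟨z, hz, -⟩ := hM ⟨u, hu⟩
  have hadj : F.Adj u z.1 := M.adj_sub hz
  have hne := f.valid hadj
  have h1 := key u (f z.1) hne.symm
  have h2 := key z.1 (f u) hne
  omega

lemma fc_odd {W : Type*} [Fintype W] {F : SimpleGraph W} (hF : IsFactorCritical F) [Nonempty W] :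
    Odd (Fintype.card W) := by
  classical
  obtain ⟨v⟩ := ‹Nonempty W›
  obtain ⟨M, hM⟩ := hF v
  have h1 := hM.even_card
  rw [Fintype.card_compl_set] at h1
  simp only [Fintype.card_unique] at h1
  have : 0 < Fintype.card W := Fintype.card_pos_iff.2 ⟨v⟩
  obtain ⟨r, hr⟩ := h1
  exact ⟨r, by omega⟩

variable {V : Type*} [DecidableEq V] [Fintype V] {G : SimpleGraph V} {X : Finset V} {k : ℕ}

/-- vertex set of a component of `G - X` -/
noncomputable def HC (c : (G.induce (X : Set V)ᶜ).ConnectedComponent) : Finset V := by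
  classical exact Finset.univ.filter (fun v =>
    ∃ h : v ∈ (X : Set V)ᶜ, (G.induce (X : Set V)ᶜ).connectedComponentMk ⟨v, h⟩ = c)

lemma mem_HC {c : (G.induce (X : Set V)ᶜ).ConnectedComponent} {v : V} : v ∈ HC c ↔
    ∃ h : v ∈ (X : Set V)ᶜ, (G.induce (X : Set V)ᶜ).connectedComponentMk ⟨v, h⟩ = c := by
  simp [HC]

lemma HC_card (c : (G.induce (X : Set V)ᶜ).ConnectedComponent) :
    (HC c).card = c.supp.ncard := by
  rw [← Set.ncard_coe_finset, ← Set.ncard_image_of_injective c.supp Subtype.val_injective]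
  congr 1
  ext v
  simp only [Finset.mem_coe, mem_HC, Set.mem_image, ConnectedComponent.mem_supp_iff]
  constructor
  · rintro ⟨h, hc⟩
    exact ⟨⟨v, h⟩, hc, rfl⟩
  · rintro ⟨u, hu, rfl⟩
    exact ⟨u.2, hu⟩

lemma HC_disj {c d : (G.induce (X : Set V)ᶜ).ConnectedComponent} (h : c ≠ d) :
    Disjoint (HC c) (HC d) := by
  rw [Finset.disjoint_left]
  intro v hv hv'
  obtain ⟨_, h1⟩ := mem_HC.1 hv
  obtain ⟨_, h2⟩ := mem_HC.1 hv'
  exact h (h1.symm.trans h2)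

lemma HC_X (c : (G.induce (X : Set V)ᶜ).ConnectedComponent) : Disjoint X (HC c) := by
  rw [Finset.disjoint_left]
  intro v hv hv'
  obtain ⟨h1, _⟩ := mem_HC.1 hv'
  exact h1 (Finset.mem_coe.2 hv)

lemma HC_nbr {c : (G.induce (X : Set V)ᶜ).ConnectedComponent} {v u : V} (hv : v ∈ HC c)
    (h : G.Adj v u) : u ∈ X ∨ u ∈ HC c := by
  by_cases hu : u ∈ X
  · exact Or.inl hu
  · right
    obtain ⟨h1, h2⟩ := mem_HC.1 hv
    have hu' : u ∈ (X : Set V)ᶜ := by simpa using hu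
    refine mem_HC.2 ⟨hu', ?_⟩
    rw [← h2]
    have : (G.induce (X : Set V)ᶜ).Adj ⟨u, hu'⟩ ⟨v, h1⟩ := h.symm
    exact ConnectedComponent.sound this.reachable

lemma exists_HC {v : V} (hv : v ∉ X) :
    ∃ c : (G.induce (X : Set V)ᶜ).ConnectedComponent, v ∈ HC c :=
  ⟨_, mem_HC.2 ⟨by simpa using hv, rfl⟩⟩

lemma HC_pos (c : (G.induce (X : Set V)ᶜ).ConnectedComponent) : 1 ≤ (HC c).card := by
  obtain ⟨v, hv⟩ := c.nonempty_supp
  exact Finset.card_pos.2 ⟨v.1, mem_HC.2 ⟨v.2, hv⟩⟩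

lemma HC_odd (c : (G.induce (X : Set V)ᶜ).ConnectedComponent)
    (hc : IsFactorCritical ((G.induce (X : Set V)ᶜ).induce c.supp)) : Odd (HC c).card := by
  classical
  have : Nonempty c.supp := c.nonempty_supp.to_subtype
  have h1 := fc_odd hc
  rwa [HC_card, ← Nat.card_coe_set_eq, Nat.card_eq_fintype_card]

lemma HC_nc (c : (G.induce (X : Set V)ᶜ).ConnectedComponent)
    (hc : IsFactorCritical ((G.induce (X : Set V)ᶜ).induce c.supp)) (h2 : 2 ≤ (HC c).card) :
    ¬ (res G (HC c)).Colorable 2 := by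
  classical
  intro hcol
  refine fc_not_colorable hc ?_ ?_
  · rwa [HC_card, ← Nat.card_coe_set_eq, Nat.card_eq_fintype_card] at h2
  · refine Colorable.of_hom (G' := res G (HC c)) ⟨fun v => v.1.1, ?_⟩ hcol
    intro u v h
    exact ⟨h, mem_HC.2 ⟨u.1.2, u.2⟩, mem_HC.2 ⟨v.1.2, v.2⟩⟩

lemma HC_one {c : (G.induce (X : Set V)ᶜ).ConnectedComponent} (h1 : (HC c).card = 1) {v u : V}
    (hv : v ∈ HC c) (h : G.Adj v u) : u ∈ X := by
  rcases HC_nbr hv h with hu | hu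
  · exact hu
  · obtain ⟨z, hz⟩ := Finset.card_eq_one.1 h1
    rw [hz, Finset.mem_singleton] at hu hv
    rw [hu, hv] at h
    exact (G.loopless.irrefl _ h).elim

lemma ge5_of {H : Finset V} (hG : TF G) (hnc : ¬ (res G H).Colorable 2) : 5 ≤ H.card := by
  obtain ⟨g, w, hw⟩ := exists_minOdd hnc
  have hTF : TF (res G H) := fun a b d h1 h2 h3 => hG a b d h1.1 h2.1 h3.1
  have hg := hw.five_le hTF
  refine hg.trans ?_
  rw [← Finset.card_range g, ← Finset.card_image_of_injOn hw.inj]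
  refine Finset.card_le_card fun u hu => ?_
  obtain ⟨i, _, rfl⟩ := Finset.mem_image.1 hu
  exact (hw.1.1 i).2.1

lemma HC_bd (c : (G.induce (X : Set V)ᶜ).ConnectedComponent) : bd G (HC c) = ee G (HC c) X := by
  have h1 : X ⊆ (HC c)ᶜ := fun u hu =>
    Finset.mem_compl.2 fun h => Finset.disjoint_left.1 (HC_X c) hu h
  unfold bd
  rw [← Finset.union_sdiff_of_subset h1, ee_union_right G _ Finset.disjoint_sdiff]
  have : ee G (HC c) ((HC c)ᶜ \ X) = 0 := by
    refine ee_zero fun v hv u hu h => ?_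
    rw [Finset.mem_sdiff, Finset.mem_compl] at hu
    rcases HC_nbr hv h with h | h
    · exact hu.2 h
    · exact hu.1 h
  omega

section sums
variable [Fintype (G.induce (X : Set V)ᶜ).ConnectedComponent]
  [DecidableEq (G.induce (X : Set V)ᶜ).ConnectedComponent]

lemma HC_union : (Finset.univ : Finset (G.induce (X : Set V)ᶜ).ConnectedComponent).biUnion HC
    = Xᶜ := by
  ext v
  simp only [Finset.mem_biUnion, Finset.mem_univ, true_and, Finset.mem_compl]
  constructor
  · rintro ⟨c, hc⟩ hX
    exact Finset.disjoint_left.1 (HC_X c) hX hc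
  · exact exists_HC

lemma HC_sum_card :
    ∑ c : (G.induce (X : Set V)ᶜ).ConnectedComponent, (HC c).card = Xᶜ.card := by
  rw [← HC_union (G := G), Finset.card_biUnion fun c _ d _ h => HC_disj h]

lemma HC_sum_bd (hr : Rg G k) :
    ∑ c : (G.induce (X : Set V)ᶜ).ConnectedComponent, bd G (HC c) ≤ k * X.card := by
  rw [Finset.sum_congr rfl fun c _ => HC_bd c]
  have h1 : ∑ c : (G.induce (X : Set V)ᶜ).ConnectedComponent, ee G (HC c) X = ee G Xᶜ X := by
    rw [← HC_union (G := G)]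
    unfold ee
    rw [Finset.sum_biUnion fun c _ d _ h => HC_disj h]
  rw [h1, ee_comm, ← ee_univ hr]
  exact ee_mono G (subset_refl _) (Finset.subset_univ _)

end sums

end VT

set_option linter.unusedSectionVars false

namespace VT
variable {V : Type*} [DecidableEq V] [Fintype V] {G : SimpleGraph V} {X : Finset V} {k : ℕ}

/-- bookkeeping for the components of `G - X` -/
theorem main (hconn : G.Connected) (hvt : VertexTransitive G) (hnb : ¬ G.Colorable 2)
    (hr : Rg G k) (hk : 5 ≤ k) (heven : Even (Fintype.card V)) (hX4 : 4 ≤ X.card)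
    (hodd : oddComponentCount G (X : Set V) = X.card - 2)
    (hfc : ∀ c : (G.induce (X : Set V)ᶜ).ConnectedComponent,
      IsFactorCritical ((G.induce (X : Set V)ᶜ).induce c.supp)) :
    1 ≤ nontrivialComponentCount G (X : Set V) ∧
    (TF G →
      (2 * k < lambdaS G 5 → nontrivialComponentCount G (X : Set V) = 1) ∧
      (4 * k - 8 < lambdaS G 5 → k ≤ 6 →
        nontrivialComponentCount G (X : Set V) = 1 ∧ 7 ≤ X.card ∧
        ∀ c : (G.induce (X : Set V)ᶜ).ConnectedComponent,
          2 ≤ c.supp.ncard → 9 ≤ c.supp.ncard) ∧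
      (14 ≤ lambdaS G 6 → k = 5 →
        nontrivialComponentCount G (X : Set V) = 1 ∧ 10 ≤ X.card ∧
        ∀ c : (G.induce (X : Set V)ᶜ).ConnectedComponent,
          2 ≤ c.supp.ncard → 15 ≤ c.supp.ncard)) := by
  classical
  have : Fintype (G.induce (X : Set V)ᶜ).ConnectedComponent := Fintype.ofFinite _
  set T2 : Finset (G.induce (X : Set V)ᶜ).ConnectedComponent :=
    Finset.univ.filter (fun c => 2 ≤ (HC c).card) with hT2
  set T1 : Finset (G.induce (X : Set V)ᶜ).ConnectedComponent :=
    Finset.univ.filter (fun c => ¬ 2 ≤ (HC c).card) with hT1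
  have hp : nontrivialComponentCount G (X : Set V) = T2.card := by
    unfold nontrivialComponentCount
    rw [← Set.ncard_coe_finset]
    congr 1
    ext c
    simp [hT2, HC_card]
  have hq : T1.card + T2.card + 2 = X.card := by
    have h1 : T2.card + T1.card = Fintype.card (G.induce (X : Set V)ᶜ).ConnectedComponent := by
      rw [hT2, hT1, Finset.card_filter_add_card_filter_not, Finset.card_univ]
    have h2 : oddComponentCount G (X : Set V)
        = Fintype.card (G.induce (X : Set V)ᶜ).ConnectedComponent := by
      unfold oddComponentCount
      rw [← Nat.card_eq_fintype_card, ← Set.ncard_univ]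
      congr 1
      ext c
      have := HC_odd c (hfc c)
      rw [HC_card] at this
      simp [this]
    omega
  have hone : ∀ c ∈ T1, (HC c).card = 1 := by
    intro c hc
    have h1 := (Finset.mem_filter.1 hc).2
    have := HC_pos c
    omega
  have hsplit : ∀ f : (G.induce (X : Set V)ᶜ).ConnectedComponent → ℕ,
      ∑ c, f c = ∑ c ∈ T2, f c + ∑ c ∈ T1, f c := by
    intro f
    rw [hT2, hT1, Finset.sum_filter_add_sum_filter_not]
  have hcards : ∑ c ∈ T2, (HC c).card + T1.card = Xᶜ.card := by
    rw [← HC_sum_card (G := G), hsplit, Finset.sum_congr rfl hone]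
    simp
  have hXc := Finset.card_add_card_compl X
  rw [hp]
  have hp1 : 1 ≤ T2.card := by
    by_contra hcon
    have h0 : T2 = ∅ := Finset.card_eq_zero.1 (by omega)
    have h0' : T2.card = 0 := by omega
    rw [h0, Finset.sum_empty] at hcards
    refine no_big_indep hvt hnb hr hk Xᶜ (Finset.card_pos.1 (by omega)) ?_ (by omega)
    intro u hu v hv h
    obtain ⟨c, hc⟩ := exists_HC (G := G) (Finset.mem_compl.1 hu)
    have hc1 : (HC c).card = 1 := by
      refine hone c ?_
      by_contra hc2
      have : c ∈ T2 := by
        rw [hT2, Finset.mem_filter]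
        refine ⟨Finset.mem_univ _, ?_⟩
        by_contra h3
        exact hc2 (by rw [hT1, Finset.mem_filter]; exact ⟨Finset.mem_univ _, h3⟩)
      rw [h0] at this
      simp at this
    exact (Finset.mem_compl.1 hv) (HC_one hc1 hc h)
  refine ⟨hp1, fun hG => ?_⟩
  have hge5 : ∀ c ∈ T2, 5 ≤ (HC c).card := fun c hc =>
    ge5_of hG (HC_nc c (hfc c) (Finset.mem_filter.1 hc).2)
  -- counting edges
  have hL : ∀ L, (∀ c ∈ T2, L ≤ bd G (HC c)) → T2.card * L + T1.card * k ≤ k * X.card := by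
    intro L h
    refine le_trans ?_ (HC_sum_bd (G := G) hr)
    rw [hsplit]
    refine Nat.add_le_add ?_ ?_
    · rw [← smul_eq_mul, ← Finset.sum_const]
      exact Finset.sum_le_sum h
    · rw [← smul_eq_mul, ← Finset.sum_const]
      refine Finset.sum_le_sum fun c hc => ?_
      have h1 := bd_add hr (HC c)
      have h2 := mantel hG (HC c)
      rw [hone c hc] at h1 h2
      omega
  -- another nontrivial component
  have hother : 2 ≤ T2.card → ∀ c ∈ T2, 9 ≤ (HC c)ᶜ.card := by
    intro h2 c hc
    obtain ⟨d, hd, hdc⟩ := Finset.exists_mem_ne (by omega : 1 < T2.card) c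
    have h3 : HC d ∪ X ⊆ (HC c)ᶜ := by
      intro u hu
      rw [Finset.mem_compl]
      intro hu'
      rcases Finset.mem_union.1 hu with h | h
      · exact Finset.disjoint_left.1 (HC_disj hdc) h hu'
      · exact Finset.disjoint_left.1 (HC_X c) h hu'
    have h4 := Finset.card_le_card h3
    rw [Finset.card_union_of_disjoint (HC_X d).symm] at h4
    have := hge5 d hd
    omega
  have ha : 2 * k < lambdaS G 5 → T2.card = 1 := by
    intro hl
    by_contra hne
    have h2 : 2 ≤ T2.card := by omega
    have h3 := hL (2 * k + 1) (fun c hc => by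
      have h4 := hother h2 c hc
      have h5 := lam hr hG 5 (by omega) (by omega) _ (HC c) rfl (hge5 c hc) (by omega)
      omega)
    rw [← hq] at h3
    nlinarith
  have hc5 : 14 ≤ lambdaS G 6 → k = 5 → T2.card = 1 := by
    intro hl hk5
    subst hk5
    by_contra hne
    have h2 : 2 ≤ T2.card := by omega
    have h3 := hL 13 (fun c hc => by
      have h4 := hother h2 c hc
      have h6 := hge5 c hc
      by_cases h7 : (HC c).card = 5
      · have h8 := bd_mantel hr hG (HC c)
        rw [h7] at h8
        omega
      · have h5 := lam hr hG 6 (by omega) (by omega) _ (HC c) rfl (by omega) (by omega)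
        omega)
    omega
  -- the core configuration
  have hcore : T2.card = 1 → ∀ c : (G.induce (X : Set V)ᶜ).ConnectedComponent,
      2 ≤ (HC c).card → Core G X (X ∪ HC c)ᶜ (HC c) := by
    intro h1 c hc
    have hcT : c ∈ T2 := by rw [hT2, Finset.mem_filter]; exact ⟨Finset.mem_univ _, hc⟩
    obtain ⟨d, hd⟩ := Finset.card_eq_one.1 h1
    have hcd : c = d := by rw [hd] at hcT; simpa using hcT
    subst hcd
    rw [hd, Finset.sum_singleton] at hcards
    have hcc := Finset.card_add_card_compl (X ∪ HC c)
    rw [Finset.card_union_of_disjoint (HC_X c)] at hcc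
    refine ⟨?_, HC_X c, ?_, ?_, ?_, fun i hi u h => HC_nbr hi h, by omega, HC_odd c (hfc c),
      HC_nc c (hfc c) hc, hX4⟩
    · rw [Finset.disjoint_left]
      intro u hu hu'
      exact (Finset.mem_compl.1 hu') (Finset.mem_union_left _ hu)
    · rw [Finset.disjoint_left]
      intro u hu hu'
      exact (Finset.mem_compl.1 hu) (Finset.mem_union_right _ hu')
    · ext u
      simp only [Finset.mem_union, Finset.mem_compl, Finset.mem_univ, iff_true]
      tauto
    · intro i hi u h
      rw [Finset.mem_compl, Finset.mem_union, not_or] at hi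
      obtain ⟨e, he⟩ := exists_HC (G := G) hi.1
      refine HC_one (hone e ?_) he h
      rw [hT1, Finset.mem_filter]
      refine ⟨Finset.mem_univ _, fun h2 => ?_⟩
      have heT : e ∈ T2 := by rw [hT2, Finset.mem_filter]; exact ⟨Finset.mem_univ _, h2⟩
      rw [hd, Finset.mem_singleton] at heT
      rw [heT] at he
      exact hi.2 he
  obtain ⟨c0, hc0⟩ := Finset.card_pos.1 hp1
  have hc0' := (Finset.mem_filter.1 hc0).2
  refine ⟨ha, ?_, ?_⟩
  · intro hl hk6
    have h1 := ha (by omega)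
    refine ⟨h1, ((hcore h1 c0 hc0').partB hr hG hconn hvt hnb heven hk hk6 hl).1, ?_⟩
    intro c hc
    rw [← HC_card] at *
    exact ((hcore h1 c hc).partB hr hG hconn hvt hnb heven hk hk6 hl).2
  · intro hl hk5
    have h1 := hc5 hl hk5
    subst hk5
    refine ⟨h1, ((hcore h1 c0 hc0').partC hr hG hvt hnb hl).1, ?_⟩
    intro c hc
    rw [← HC_card] at *
    exact ((hcore h1 c hc).partC hr hG hvt hnb hl).2

end VT

/-- (Lemma 3.4) `G` connected vertex-transitive non-bipartite
of degree `k ≥ 5` and even order, not 4-factor-critical; `X` with `|X| ≥ 4`,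
`c₀(G − X) = |X| − 2`, all components of `G − X` factor-critical; `p` the number
of nontrivial components of `G − X`. Then `p ≥ 1`, and if `G` is triangle-free:
(a) `λ₅(G) > 2k → p = 1`; (b) `λ₅(G) > 4k − 8` and `5 ≤ k ≤ 6` imply `p = 1`,
`|X| ≥ 7` and every nontrivial component has at least 9 vertices; (c)
`λ₆(G) ≥ 14` and `k = 5` imply `p = 1`, `|X| ≥ 10` and every nontrivial
component has at least 15 vertices. -/
theorem statement12 {V : Type*} [Fintype V] [DecidableEq V]
    (G : SimpleGraph V) [DecidableRel G.Adj] (k : ℕ)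
    (hconn : G.Connected) (hvt : VertexTransitive G) (hnb : ¬ G.Colorable 2)
    (hreg : G.IsRegularOfDegree k) (hk : 5 ≤ k) (heven : Even (Fintype.card V))
    (hnfc : ¬ PFactorCritical G 4)
    (X : Set V) (hX4 : 4 ≤ X.ncard)
    (hodd : oddComponentCount G X = X.ncard - 2)
    (hfc : ∀ c : (G.induce Xᶜ).ConnectedComponent,
      IsFactorCritical ((G.induce Xᶜ).induce c.supp)) :
    1 ≤ nontrivialComponentCount G X ∧
    (G.CliqueFree 3 →
      (2 * k < lambdaS G 5 → nontrivialComponentCount G X = 1) ∧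
      (4 * k - 8 < lambdaS G 5 → k ≤ 6 →
        nontrivialComponentCount G X = 1 ∧ 7 ≤ X.ncard ∧
        ∀ c : (G.induce Xᶜ).ConnectedComponent,
          2 ≤ c.supp.ncard → 9 ≤ c.supp.ncard) ∧
      (14 ≤ lambdaS G 6 → k = 5 →
        nontrivialComponentCount G X = 1 ∧ 10 ≤ X.ncard ∧
        ∀ c : (G.induce Xᶜ).ConnectedComponent,
          2 ≤ c.supp.ncard → 15 ≤ c.supp.ncard)) := by
  lift X to Finset V using X.toFinite
  rw [Set.ncard_coe_finset] at *
  have hr : VT.Rg G k := by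
    intro v
    rw [VT.dg_eq_card, ← hreg v, ← SimpleGraph.card_neighborFinset_eq_degree,
      SimpleGraph.neighborFinset_eq_filter]
  obtain ⟨h1, h2⟩ := VT.main hconn hvt hnb hr hk heven hX4 hodd hfc
  exact ⟨h1, fun hcf => h2 (VT.TF_of_cliqueFree hcf)⟩
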